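/- arXiv:2012.11115 — 4 statements merged into one kernel-verified Lean document; each statement's English description precedes it below -/
import Mathlib

section
/- Let A = (A_1, …, A_d) be a commuting projectively hyponormal (respectively, jointly hyponormal) d-tuple of bounded operators on a complex Hilbert space H₁ and let T be a hyponormal bounded operator on a complex Hilbert space H₂. Then A ⊗ T := (A_1 ⊗ T, …, A_d ⊗ T) is a commuting projectively hyponormal (respectively, jointly hyponormal) d-tuple of bounded operators on the Hilbert space tensor product H₁ ⊗ H₂. -/
open ContinuousLinearMap MeasureTheory
open scoped ENNReal NNReal ComplexOrder

noncomputable section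

variable {H H₁ H₂ K : Type*}
variable [NormedAddCommGroup H] [InnerProductSpace ℂ H] [CompleteSpace H]
variable [NormedAddCommGroup H₁] [InnerProductSpace ℂ H₁] [CompleteSpace H₁]
variable [NormedAddCommGroup H₂] [InnerProductSpace ℂ H₂] [CompleteSpace H₂]
variable [NormedAddCommGroup K] [InnerProductSpace ℂ K] [CompleteSpace K]

/-- The commutator `[A, B] = A * B - B * A` of two bounded operators. -/
def cmt (A B : H →L[ℂ] H) : H →L[ℂ] H := A * B - B * A

/-- A bounded operator `T` is hyponormal if `[T*, T] ≥ 0`. -/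
def Hyponormal (T : H →L[ℂ] H) : Prop := (cmt (adjoint T) T).IsPositive

/-- A `d`-tuple is projectively hyponormal if every linear combination is hyponormal. -/
def ProjHyponormal {d : ℕ} (T : Fin d → H →L[ℂ] H) : Prop :=
  ∀ α : Fin d → ℂ, Hyponormal (∑ i, α i • T i)

/-- A `d`-tuple is jointly hyponormal if the block operator `(([T j*, T i]))` is
non-negative definite on the `d`-fold direct sum. -/
def JointlyHyponormal {d : ℕ} (T : Fin d → H →L[ℂ] H) : Prop :=
  ∀ x : Fin d → H, 0 ≤ ∑ i, ∑ j, @inner ℂ _ _ (x i) (cmt (adjoint (T j)) (T i) (x j))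

/-- The trace norm `‖T‖₁ = sup Σ |⟨T fᵢ, gᵢ⟩|`, the supremum being taken over all pairs of
(finite) orthonormal families. -/
def traceNorm (T : H →L[ℂ] H) : ℝ≥0∞ :=
  ⨆ (n : ℕ) (f : Fin n → H) (g : Fin n → H) (_ : Orthonormal ℂ f) (_ : Orthonormal ℂ g),
    ∑ i, (‖@inner ℂ _ _ (T (f i)) (g i)‖₊ : ℝ≥0∞)

/-- A bounded operator is trace class if its trace norm is finite. -/
def IsTraceClass (T : H →L[ℂ] H) : Prop := traceNorm T ≠ ⊤

/-- The Hilbert-Schmidt norm `‖T‖₂ = (Σ ‖T eₙ‖²)^(1/2)`. -/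
def hsNorm (T : H →L[ℂ] H) : ℝ≥0∞ :=
  (⨆ (n : ℕ) (f : Fin n → H) (_ : Orthonormal ℂ f), ∑ i, (‖T (f i)‖₊ : ℝ≥0∞) ^ 2) ^ (1/2 : ℝ)

/-- The word `T₁^(n 1) ⋯ T d^(n d)` in a `d`-tuple of operators. -/
def opWord {d : ℕ} (T : Fin d → H →L[ℂ] H) (n : Fin d → ℕ) : H →L[ℂ] H :=
  (List.ofFn fun j => (T j) ^ (n j)).prod

/-- A single operator is `m`-polynomially cyclic if `m` is the least cardinality of a finite
set `ξ` such that the span of `{T^n v : v ∈ ξ, n ≥ 0}` is dense. -/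
def IsPolyCyclicOp (T : H →L[ℂ] H) (m : ℕ) : Prop :=
  IsLeast {k : ℕ | ∃ ξ : Finset H, ξ.card = k ∧
    Dense ((Submodule.span ℂ {x | ∃ v ∈ ξ, ∃ n : ℕ, x = (T ^ n) v} : Submodule ℂ H) : Set H)} m

/-- A commuting `d`-tuple is `m`-polynomially cyclic if `m` is the least cardinality of a finite
set `ξ` such that the span of `{T₁^{i₁} ⋯ T_d^{i_d} v : v ∈ ξ}` is dense. -/
def IsPolyCyclicTuple {d : ℕ} (T : Fin d → H →L[ℂ] H) (m : ℕ) : Prop :=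
  IsLeast {k : ℕ | ∃ ξ : Finset H, ξ.card = k ∧
    Dense ((Submodule.span ℂ {x | ∃ v ∈ ξ, ∃ n : Fin d → ℕ, x = opWord T n v} :
      Submodule ℂ H) : Set H)} m

/-- The determinant operator `dEt [[T*, T]]` of the block operator of commutators
`B i j = [T j*, T i]`, given by the symmetrized Laplace expansion. -/
def detOp {d : ℕ} (T : Fin d → H →L[ℂ] H) : H →L[ℂ] H :=
  ∑ σ : Equiv.Perm (Fin d), ∑ τ : Equiv.Perm (Fin d),
    ((Equiv.Perm.sign σ : ℤ) •
      (List.ofFn fun k => cmt (adjoint (T (σ (τ k)))) (T (τ k))).prod)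

/-- The standard polynomial `S n (A 1, …, A n) = Σ_σ sgn σ • A σ(1) ⋯ A σ(n)`. -/
def stdPoly {n : ℕ} (A : Fin n → H →L[ℂ] H) : H →L[ℂ] H :=
  ∑ σ : Equiv.Perm (Fin n), ((Equiv.Perm.sign σ : ℤ) • (List.ofFn fun k => A (σ k)).prod)

/-- The generalized commutator `GC(T*, T) = S_{2d}(T₁*, T₁, …, T_d*, T_d)` of Helton-Howe. -/
def genComm {d : ℕ} (T : Fin d → H →L[ℂ] H) : H →L[ℂ] H :=
  stdPoly (fun j : Fin (2 * d) =>
    if (j : ℕ) % 2 = 0 then adjoint (T ⟨(j : ℕ) / 2, by have := j.isLt; omega⟩)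
    else T ⟨(j : ℕ) / 2, by have := j.isLt; omega⟩)

/-- `P` is the orthogonal projection onto the subspace `K'`. -/
def IsOrthProjOn (P : H →L[ℂ] H) (K' : Submodule ℂ H) : Prop :=
  IsSelfAdjoint P ∧ (∀ x, P x ∈ K') ∧ (∀ x ∈ K', P x = x)

/-- The subspace `H_N` spanned by words of total degree at most `N` applied to `ξ`. -/
def HN {d : ℕ} (T : Fin d → H →L[ℂ] H) (ξ : Finset H) (N : ℕ) : Submodule ℂ H :=
  Submodule.span ℂ {x | ∃ v ∈ ξ, ∃ n : Fin d → ℕ, (∑ j, n j) ≤ N ∧ x = opWord T n v}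

/-- The word `T*_{η 1} T_{τ 1} T*_{η 2} T_{τ 2} ⋯ T_{τ (d-1)} T*_{η d}`. -/
def wordB {d : ℕ} (T : Fin d → H →L[ℂ] H) (η τ : Equiv.Perm (Fin d)) : H →L[ℂ] H :=
  (List.ofFn fun k : Fin d =>
    if (k : ℕ) + 1 = d then adjoint (T (η k)) else adjoint (T (η k)) * T (τ k)).prod

/-- The operator `P_N (Σ_η sgn η T*_{η 1} T_{τ 1} ⋯ T*_{η d}) P_N^⊥ T_{τ d} P_N`. -/
def bsExpr {d : ℕ} (hd : 0 < d) (T : Fin d → H →L[ℂ] H) (P : ℕ → H →L[ℂ] H)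
    (τ : Equiv.Perm (Fin d)) (N : ℕ) : H →L[ℂ] H :=
  P N * (∑ η : Equiv.Perm (Fin d), (Equiv.Perm.sign η : ℤ) • wordB T η τ) *
    ((1 - P N) * T (τ ⟨d - 1, by omega⟩) * P N)

/-- The class `BS_{m, θ}`. -/
def InBS {d : ℕ} (hd : 0 < d) (T : Fin d → H →L[ℂ] H) (m θ : ℕ) : Prop :=
  IsPolyCyclicTuple T m ∧ (detOp T).IsPositive ∧
  ∃ ξ : Finset H, ξ.card = m ∧
    Dense ((Submodule.span ℂ {x | ∃ v ∈ ξ, ∃ n : Fin d → ℕ, x = opWord T n v} :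
      Submodule ℂ H) : Set H) ∧
    ∃ P : ℕ → H →L[ℂ] H, (∀ N, IsOrthProjOn (P N) (HN T ξ N)) ∧
      (∀ (N : ℕ) (j : Fin d), P N * T j * (1 - P N) = 0) ∧
      (∀ (τ : Equiv.Perm (Fin d)) (N : ℕ),
        ‖bsExpr hd T P τ N‖ ≤
          (θ : ℝ) * (((N + d - 1).choose (d - 1) : ℝ))⁻¹ * ∏ i, ‖T i‖ ^ 2)

/-- Evaluation of a polynomial in `d` commuting variables on a commuting `d`-tuple. -/
def evalPoly {d : ℕ} (T : Fin d → H →L[ℂ] H) (p : MvPolynomial (Fin d) ℂ) : H →L[ℂ] H :=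
  ∑ mo ∈ p.support, MvPolynomial.coeff mo p • opWord T (fun i => mo i)

/-- A pure hyponormal operator: no nonzero closed subspace, reducing for `T`, on which `T`
restricts to a normal operator. -/
def IsPureHyponormal (T : H →L[ℂ] H) : Prop :=
  Hyponormal T ∧ ∀ K' : Submodule ℂ H, IsClosed (K' : Set H) →
    (∀ x ∈ K', T x ∈ K') → (∀ x ∈ K', adjoint T x ∈ K') →
    (∀ x ∈ K', ‖T x‖ = ‖adjoint T x‖) → K' = ⊥

/-- `tmul` realises `H` as the Hilbert space tensor product of `H₁` and `H₂`. -/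
structure IsHilbertTensor (tmul : H₁ →ₗ[ℂ] H₂ →ₗ[ℂ] H) : Prop where
  inner_tmul : ∀ x₁ x₂ y₁ y₂,
    @inner ℂ _ _ (tmul x₁ x₂) (tmul y₁ y₂) = @inner ℂ _ _ x₁ y₁ * @inner ℂ _ _ x₂ y₂
  dense_span :
    Dense ((Submodule.span ℂ {z | ∃ x y, z = tmul x y} : Submodule ℂ H) : Set H)

/-- `C` is the tensor product operator `A ⊗ B` relative to `tmul`. -/
def IsTensorOp (tmul : H₁ →ₗ[ℂ] H₂ →ₗ[ℂ] H) (A : H₁ →L[ℂ] H₁) (B : H₂ →L[ℂ] H₂)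
    (C : H →L[ℂ] H) : Prop :=
  ∀ x y, C (tmul x y) = tmul (A x) (B y)

lemma inner_cmt (S T : H →L[ℂ] H) (x y : H) :
    @inner ℂ _ _ x (cmt (adjoint S) T y)
      = @inner ℂ _ _ (S x) (T y) - @inner ℂ _ _ (adjoint T x) (adjoint S y) := by
  rw [adjoint_inner_left, ← adjoint_inner_right S x]
  exact inner_sub_right _ _ _

lemma tensor_ext {tmul : H₁ →ₗ[ℂ] H₂ →ₗ[ℂ] H} (h : IsHilbertTensor tmul)
    {f g : H →L[ℂ] K} (hfg : ∀ x y, f (tmul x y) = g (tmul x y)) : f = g := by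
  apply ContinuousLinearMap.ext_on h.dense_span
  rintro z ⟨x, y, rfl⟩
  exact hfg x y

lemma tensor_adjoint {tmul : H₁ →ₗ[ℂ] H₂ →ₗ[ℂ] H} (h : IsHilbertTensor tmul)
    {A : H₁ →L[ℂ] H₁} {B : H₂ →L[ℂ] H₂} {C : H →L[ℂ] H} (hC : IsTensorOp tmul A B C) :
    IsTensorOp tmul (adjoint A) (adjoint B) (adjoint C) := by
  intro x y
  have : innerSL ℂ (adjoint C (tmul x y)) = innerSL ℂ (tmul (adjoint A x) (adjoint B y)) := by
    apply tensor_ext h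
    intro u v
    simp only [innerSL_apply_apply]
    rw [adjoint_inner_left, hC, h.inner_tmul, h.inner_tmul, adjoint_inner_left, adjoint_inner_left]
  apply ext_inner_right ℂ
  intro v
  simpa using DFunLike.congr_fun this v

lemma mem_span_tensor {tmul : H₁ →ₗ[ℂ] H₂ →ₗ[ℂ] H} {z : H}
    (hz : z ∈ Submodule.span ℂ {z | ∃ x y, z = tmul x y}) :
    ∃ (n : ℕ) (a : Fin n → H₁) (b : Fin n → H₂), z = ∑ k, tmul (a k) (b k) := by
  obtain ⟨n, f, g, rfl⟩ := Submodule.mem_span_set'.1 hz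
  choose x y hxy using fun k => (g k).2
  refine ⟨n, fun k => f k • x k, y, ?_⟩
  simp [hxy]

lemma psd_of {ι : Type*} [Fintype ι] (M : Matrix ι ι ℂ) (h1 : ∀ p q, star (M q p) = M p q)
    (h2 : ∀ c : ι → ℂ, 0 ≤ ∑ p, ∑ q, star (c p) * (M p q * c q)) : M.PosSemidef := by
  refine .of_dotProduct_mulVec_nonneg (Matrix.ext h1) fun c => ?_
  simpa [dotProduct, Matrix.mulVec, Finset.mul_sum] using h2 c

lemma psd_sum {ι : Type*} [Fintype ι] {M : Matrix ι ι ℂ} (h : M.PosSemidef) :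
    0 ≤ ∑ p, ∑ q, M p q := by
  simpa [dotProduct, Matrix.mulVec] using h.dotProduct_mulVec_nonneg (fun _ => 1)

lemma cmt_star (S T : H →L[ℂ] H) (x y : H) :
    star (@inner ℂ _ _ x (cmt (adjoint S) T y)) = @inner ℂ _ _ y (cmt (adjoint T) S x) := by
  simp [inner_cmt]

lemma joint_tensor {d : ℕ}
    (A : Fin d → H₁ →L[ℂ] H₁) (T : H₂ →L[ℂ] H₂) (hT : Hyponormal T)
    (tmul : H₁ →ₗ[ℂ] H₂ →ₗ[ℂ] H) (htmul : IsHilbertTensor tmul)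
    (AT : Fin d → H →L[ℂ] H) (hAT : ∀ i, IsTensorOp tmul (A i) T (AT i))
    (hA : JointlyHyponormal A) : JointlyHyponormal AT := by
  intro x
  have hd := dense_pi (Set.univ : Set (Fin d)) (fun _ _ => htmul.dense_span)
  refine hd.induction (P := fun x : Fin d → H => 0 ≤ ∑ i, ∑ j,
    @inner ℂ _ _ (x i) (cmt (adjoint (AT j)) (AT i) (x j))) ?_ ?_ x
  · intro x hx
    choose n a b hab using fun i => mem_span_tensor (hx i (Set.mem_univ i))
    let a' : (Σ i, Fin (n i)) → H₁ := fun p => a p.1 p.2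
    let b' : (Σ i, Fin (n i)) → H₂ := fun p => b p.1 p.2
    let M1 : Matrix (Σ i, Fin (n i)) (Σ i, Fin (n i)) ℂ := fun p q =>
      @inner ℂ _ _ (a' p) (cmt (adjoint (A q.1)) (A p.1) (a' q))
    let M2 : Matrix (Σ i, Fin (n i)) (Σ i, Fin (n i)) ℂ := fun p q =>
      @inner ℂ _ _ (b' p) (cmt (adjoint T) T (b' q))
    have h1 : M1.PosSemidef := by
      refine psd_of _ (fun p q => cmt_star _ _ _ _) fun c => ?_
      have := hA (fun i => ∑ k, c ⟨i, k⟩ • a i k)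
      simp only [map_sum, map_smul, sum_inner, inner_sum, inner_smul_left, inner_smul_right,
        Finset.mul_sum] at this
      convert this using 1
      rw [Fintype.sum_sigma]
      refine Finset.sum_congr rfl fun i _ => ?_
      simp only [Fintype.sum_sigma]
      rw [Finset.sum_comm]
      refine Finset.sum_congr rfl fun j _ => ?_
      rw [Finset.sum_comm]
      refine Finset.sum_congr rfl fun k _ => Finset.sum_congr rfl fun l _ => ?_
      simp only [M1, a', RCLike.star_def]
      ring
    have h2 : M2.PosSemidef := by
      refine psd_of _ (fun p q => cmt_star _ _ _ _) fun c => ?_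
      have := hT.inner_nonneg_right (∑ p, c p • b' p)
      simp only [map_sum, map_smul, sum_inner, inner_sum, inner_smul_left, inner_smul_right,
        Finset.mul_sum] at this
      convert this using 1
      rw [Finset.sum_comm]
      refine Finset.sum_congr rfl fun k _ => Finset.sum_congr rfl fun l _ => ?_
      simp only [M2, RCLike.star_def]
      ring
    have h3 := Matrix.posSemidef_gram ℂ (fun p => T (b' p))
    have h4 := Matrix.posSemidef_gram ℂ (fun p : (Σ i, Fin (n i)) => adjoint (A p.1) (a' p))
    have := psd_sum ((h1.hadamard h3).add (h4.hadamard h2))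
    convert this using 1
    rw [Fintype.sum_sigma]
    refine Finset.sum_congr rfl fun i _ => ?_
    simp only [Fintype.sum_sigma]
    rw [Finset.sum_comm (s := (Finset.univ : Finset (Fin (n i))))]
    refine Finset.sum_congr rfl fun j _ => ?_
    rw [hab i, hab j]
    simp only [map_sum, sum_inner, inner_sum]
    rw [Finset.sum_comm]
    refine Finset.sum_congr rfl fun k _ => Finset.sum_congr rfl fun l _ => ?_
    rw [Matrix.add_apply, Matrix.hadamard_apply, Matrix.hadamard_apply, Matrix.gram_apply,
      Matrix.gram_apply]
    simp only [inner_cmt, hAT _ _ _, tensor_adjoint htmul (hAT _) _ _, htmul.inner_tmul, M1, M2,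
      a', b']
    ring
  · exact isClosed_le continuous_const (by fun_prop)

lemma hypo_iff (S : H →L[ℂ] H) :
    Hyponormal S ↔ JointlyHyponormal (fun _ : Fin 1 => S) := by
  constructor
  · intro h x
    simpa using h.inner_nonneg_right (x 0)
  · intro h
    refine (ContinuousLinearMap.isPositive_iff _).2 ⟨?_, ?_⟩
    · intro x y
      have := cmt_star S S y x
      simp only [RCLike.star_def, inner_conj_symm] at this
      exact this
    · intro x
      have := h (fun _ => x)
      have h2 := cmt_star S S x x
      simp only [RCLike.star_def, inner_conj_symm] at h2
      simp only [Finset.univ_unique, Finset.sum_singleton] at this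
      rw [h2]
      exact this

/-- tensoring a commuting projectively (resp. jointly) hyponormal tuple with a
hyponormal operator yields a commuting projectively (resp. jointly) hyponormal tuple. -/
theorem statement_0 {d : ℕ}
    (A : Fin d → H₁ →L[ℂ] H₁) (T : H₂ →L[ℂ] H₂)
    (hAcomm : ∀ i j, Commute (A i) (A j)) (hT : Hyponormal T)
    (tmul : H₁ →ₗ[ℂ] H₂ →ₗ[ℂ] H) (htmul : IsHilbertTensor tmul)
    (AT : Fin d → H →L[ℂ] H) (hAT : ∀ i, IsTensorOp tmul (A i) T (AT i)) :
    (∀ i j, Commute (AT i) (AT j)) ∧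
      (ProjHyponormal A → ProjHyponormal AT) ∧
      (JointlyHyponormal A → JointlyHyponormal AT) := by
  refine ⟨fun i j => ?_, fun h α => ?_, joint_tensor A T hT tmul htmul AT hAT⟩
  · refine tensor_ext htmul fun x y => ?_
    change AT i (AT j (tmul x y)) = AT j (AT i (tmul x y))
    have : A i (A j x) = A j (A i x) := DFunLike.congr_fun (hAcomm i j).eq x
    rw [hAT j, hAT i, hAT i, hAT j]
    rw [this]
  · rw [hypo_iff]
    refine joint_tensor (fun _ => ∑ i, α i • A i) T hT tmul htmul _ (fun _ x y => ?_)
      ((hypo_iff _).1 (h α))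
    simp [hAT _ _ _]
end
end

section
/- Let A = (A_1, …, A_d) be a d-tuple of commuting normal Hilbert–Schmidt operators on a complex Hilbert space H₁ and let T be a hyponormal, m-polynomially cyclic bounded operator on a complex separable Hilbert space H₂. Then A ⊗ T := (A_1 ⊗ T, …, A_d ⊗ T) is a commuting jointly hyponormal d-tuple of operators on H₁ ⊗ H₂, and for all 1 ≤ i, j ≤ d the commutator [(A_j ⊗ T)*, A_i ⊗ T] is trace class with ‖[(A_j ⊗ T)*, A_i ⊗ T]‖₁ ≤ (m/π) ν(σ(T)) ‖A_i‖₂ ‖A_j‖₂, where ν is planar Lebesgue measure and σ(T) is the spectrum of T. -/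
open ContinuousLinearMap MeasureTheory
open scoped ENNReal NNReal ComplexOrder

noncomputable section

variable {H H₁ H₂ K : Type*}
variable [NormedAddCommGroup H] [InnerProductSpace ℂ H] [CompleteSpace H]
variable [NormedAddCommGroup H₁] [InnerProductSpace ℂ H₁] [CompleteSpace H₁]
variable [NormedAddCommGroup H₂] [InnerProductSpace ℂ H₂] [CompleteSpace H₂]
variable [NormedAddCommGroup K] [InnerProductSpace ℂ K] [CompleteSpace K]

set_option linter.unusedSectionVars false

section SpectralPart

open Polynomial Filter Topology

lemma bs_pow_tendsto_zero {A : Type*} [NormedRing A] [NormedAlgebra ℂ A] [CompleteSpace A] (a : A)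
    (h : spectrum ℂ a ⊆ Metric.ball 0 1) : Tendsto (fun n : ℕ => a ^ n) atTop (𝓝 0) := by
  rcases subsingleton_or_nontrivial A with hA | hA
  · have : (fun n : ℕ => a ^ n) = fun _ => 0 := by
      funext n; exact Subsingleton.elim _ _
    rw [this]; exact tendsto_const_nhds
  have h1 : spectralRadius ℂ a < 1 := by
    have := spectrum.spectralRadius_lt_of_forall_lt a (r := 1) (fun z hz => by
      have := h hz
      simp only [Metric.mem_ball, dist_zero_right] at this
      exact_mod_cast this)
    simpa using this
  obtain ⟨r, hr1, hr2⟩ := ENNReal.lt_iff_exists_nnreal_btwn.1 h1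
  have h2 := spectrum.pow_nnnorm_pow_one_div_tendsto_nhds_spectralRadius a
  have h3 := h2.eventually (gt_mem_nhds hr1)
  have hr : r < 1 := by exact_mod_cast hr2
  have h4 : Tendsto (fun n : ℕ => (r : ℝ) ^ n) atTop (𝓝 0) :=
    tendsto_pow_atTop_nhds_zero_of_lt_one r.2 (by exact_mod_cast hr)
  refine squeeze_zero_norm' ?_ h4
  filter_upwards [h3, eventually_gt_atTop 0] with n hn hn0
  have h5 : (‖a ^ n‖₊ : ℝ≥0∞) ≤ (r : ℝ≥0∞) ^ n := by
    have h6 : ((‖a ^ n‖₊ : ℝ≥0∞) ^ (1 / n : ℝ)) ^ (n : ℝ) ≤ (r : ℝ≥0∞) ^ (n : ℝ) :=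
      ENNReal.rpow_le_rpow hn.le (by positivity)
    rw [← ENNReal.rpow_mul, one_div, inv_mul_cancel₀ (by positivity), ENNReal.rpow_one,
      ENNReal.rpow_natCast] at h6
    exact h6
  exact_mod_cast h5

lemma bs_inverse_in {A : Type*} [NormedRing A] [NormedAlgebra ℂ A] [CompleteSpace A] (a : A)
    (h : spectrum ℂ a ⊆ Metric.ball 0 1) :
    Tendsto (fun n : ℕ => Ring.inverse (1 - a ^ n)) atTop (𝓝 1) ∧
      ∀ᶠ n : ℕ in atTop, IsUnit (1 - a ^ n) := by
  have h1 := bs_pow_tendsto_zero a h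
  have h2 : Tendsto (fun n : ℕ => 1 - a ^ n) atTop (𝓝 1) := by
    simpa using tendsto_const_nhds (x := (1 : A)).sub h1
  constructor
  · have h3 := (NormedRing.inverse_continuousAt (1 : Aˣ))
    have := h3.tendsto.comp (by simpa using h2)
    simpa [Function.comp_def] using this
  · have := h2.eventually (Units.nhds (1 : Aˣ))
    simpa using this

lemma bs_inverse_out {A : Type*} [NormedRing A] [NormedAlgebra ℂ A] [CompleteSpace A] (a : A)
    (h : Disjoint (spectrum ℂ a) (Metric.closedBall 0 1)) :
    Tendsto (fun n : ℕ => Ring.inverse (1 - a ^ n)) atTop (𝓝 0) ∧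
      ∀ᶠ n : ℕ in atTop, IsUnit (1 - a ^ n) := by
  have h0 : (0 : ℂ) ∉ spectrum ℂ a := fun h' => Set.disjoint_left.1 h h' (by simp)
  obtain ⟨u, rfl⟩ := spectrum.isUnit_of_zero_notMem ℂ h0
  have hs : spectrum ℂ ((u⁻¹ : Aˣ) : A) ⊆ Metric.ball 0 1 := by
    intro z hz
    rw [← spectrum.map_inv, Set.mem_inv] at hz
    have h1 := Set.disjoint_left.1 h hz
    simp only [Metric.mem_closedBall, dist_zero_right, norm_inv, not_le] at h1
    simp only [Metric.mem_ball, dist_zero_right]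
    by_contra hcon
    have : ‖z‖⁻¹ ≤ 1 := inv_le_one_of_one_le₀ (not_lt.1 hcon)
    linarith
  obtain ⟨h1, h2⟩ := bs_inverse_in _ hs
  have h3 := bs_pow_tendsto_zero _ hs
  have key : ∀ n : ℕ, (1 : A) - (u : A) ^ n =
      (-(u ^ n) : Aˣ) * (1 - ((u⁻¹ : Aˣ) : A) ^ n) := by
    intro n
    rw [mul_sub, mul_one]
    have : ((-(u ^ n) : Aˣ) : A) * ((u⁻¹ : Aˣ) : A) ^ n = -1 := by
      rw [Units.val_neg, Units.val_pow_eq_pow_val, neg_mul, ← Units.val_pow_eq_pow_val,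
        ← Units.val_pow_eq_pow_val, ← Units.val_mul, inv_pow, mul_inv_cancel]
      simp
    rw [this]
    simp only [Units.val_neg, Units.val_pow_eq_pow_val]
    abel
  constructor
  · have h4 := (h1.mul h3).neg
    simp only [mul_zero, neg_zero] at h4
    refine h4.congr' ?_
    filter_upwards [h2] with n hn
    obtain ⟨v, hv⟩ := hn
    rw [key, ← hv, ← Units.val_mul, Ring.inverse_unit, Ring.inverse_unit, mul_inv_rev]
    rw [← Units.val_pow_eq_pow_val, Units.val_mul, inv_neg]
    simp
  · filter_upwards [h2] with n hn
    rw [key]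
    exact (Units.isUnit _).mul hn

/-- The polynomial `1 - ((z - c) / ρ) ^ n`. -/
def bsPoly (c : ℂ) (ρ : ℝ) (n : ℕ) : ℂ[X] := 1 - (C ((ρ : ℂ)⁻¹) * (X - C c)) ^ n

lemma bs_aeval {A : Type*} [Ring A] [Algebra ℂ A] (b : A) (c : ℂ) (ρ : ℝ) (n : ℕ) :
    aeval b (bsPoly c ρ n) = 1 - ((ρ : ℂ)⁻¹ • (b - algebraMap ℂ A c)) ^ n := by
  simp [bsPoly, Algebra.smul_def]

lemma bs_spec_shift {A : Type*} [Ring A] [Algebra ℂ A] (b : A) (c : ℂ) (ρ : ℝ)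
    (hρ : 0 < ρ) (z : ℂ) (hz : z ∈ spectrum ℂ ((ρ : ℂ)⁻¹ • (b - algebraMap ℂ A c))) :
    (ρ : ℂ) * z + c ∈ spectrum ℂ b := by
  have hρ' : (ρ : ℂ) ≠ 0 := by exact_mod_cast hρ.ne'
  rw [spectrum.mem_iff] at hz ⊢
  intro hu
  apply hz
  have : algebraMap ℂ A z - (ρ : ℂ)⁻¹ • (b - algebraMap ℂ A c) =
      (ρ : ℂ)⁻¹ • (algebraMap ℂ A ((ρ : ℂ) * z + c) - b) := by
    rw [map_add, map_mul, ← Algebra.smul_def, smul_sub, smul_sub, smul_add, smul_smul,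
      inv_mul_cancel₀ hρ', one_smul]
    abel
  rw [this]
  exact hu.smul (Units.mk0 ((ρ : ℂ)⁻¹) (inv_ne_zero hρ'))

lemma bs_poly_in {A : Type*} [NormedRing A] [NormedAlgebra ℂ A] [CompleteSpace A] (b : A)
    (c : ℂ) (ρ : ℝ) (hρ : 0 < ρ) (h : spectrum ℂ b ⊆ Metric.ball c ρ) :
    Tendsto (fun n : ℕ => Ring.inverse (aeval b (bsPoly c ρ n))) atTop (𝓝 1) ∧
      ∀ᶠ n : ℕ in atTop, IsUnit (aeval b (bsPoly c ρ n)) := by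
  simp only [bs_aeval]
  apply bs_inverse_in
  intro z hz
  have h1 := h (bs_spec_shift b c ρ hρ z hz)
  simp only [Metric.mem_ball, dist_eq_norm, add_sub_cancel_right, norm_mul, Complex.norm_real,
    Real.norm_of_nonneg hρ.le, sub_zero] at h1 ⊢
  nlinarith

lemma bs_poly_out {A : Type*} [NormedRing A] [NormedAlgebra ℂ A] [CompleteSpace A] (b : A)
    (c : ℂ) (ρ : ℝ) (hρ : 0 < ρ) (h : Disjoint (spectrum ℂ b) (Metric.closedBall c ρ)) :
    Tendsto (fun n : ℕ => Ring.inverse (aeval b (bsPoly c ρ n))) atTop (𝓝 0) ∧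
      ∀ᶠ n : ℕ in atTop, IsUnit (aeval b (bsPoly c ρ n)) := by
  simp only [bs_aeval]
  apply bs_inverse_out
  rw [Set.disjoint_left]
  intro z hz hz1
  refine Set.disjoint_left.1 h (bs_spec_shift b c ρ hρ z hz) ?_
  simp only [Metric.mem_closedBall, dist_eq_norm, add_sub_cancel_right, norm_mul,
    Complex.norm_real, Real.norm_of_nonneg hρ.le, sub_zero] at hz1 ⊢
  nlinarith

lemma bs_cancel {A : Type*} [Ring A] (h a : A) (hh : IsUnit h) (ha : IsUnit a) :
    a * Ring.inverse (h * a) = Ring.inverse h := by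
  obtain ⟨u, rfl⟩ := hh
  obtain ⟨v, rfl⟩ := ha
  rw [← Units.val_mul, Ring.inverse_unit, Ring.inverse_unit, mul_inv_rev, Units.val_mul,
    ← mul_assoc, Units.mul_inv, one_mul]

/-- Numerators: `some i` picks the disc `i`; `none` picks the complement of all the discs. -/
def bsNum {n : ℕ} (c : Fin n → ℂ) (ρ : Fin n → ℝ) (k : ℕ) : Option (Fin n) → ℂ[X]
  | some i => ∏ l ∈ Finset.univ.erase i, bsPoly (c l) (ρ l) k
  | none => (∏ l, bsPoly (c l) (ρ l) k) -
      ∑ i, ∏ l ∈ Finset.univ.erase i, bsPoly (c l) (ρ l) k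

lemma bs_num_tendsto {A : Type*} [NormedRing A] [NormedAlgebra ℂ A] [CompleteSpace A] (b : A)
    {n : ℕ} (c : Fin n → ℂ) (ρ : Fin n → ℝ) (hρ : ∀ i, 0 < ρ i) (o : Option (Fin n))
    (hin : ∀ i, o = some i → spectrum ℂ b ⊆ Metric.ball (c i) (ρ i))
    (hout : ∀ i, o ≠ some i → Disjoint (spectrum ℂ b) (Metric.closedBall (c i) (ρ i)))
    (o' : Option (Fin n)) :
    Tendsto (fun k : ℕ => aeval b (bsNum c ρ k o') *
      Ring.inverse (aeval b (∏ l, bsPoly (c l) (ρ l) k))) atTop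
      (𝓝 (if o' = o then 1 else 0)) := by
  have hunit : ∀ᶠ k : ℕ in atTop, ∀ i, IsUnit (aeval b (bsPoly (c i) (ρ i) k)) := by
    rw [Filter.eventually_all]
    intro i
    by_cases hi : o = some i
    · exact (bs_poly_in b _ _ (hρ i) (hin i hi)).2
    · exact (bs_poly_out b _ _ (hρ i) (hout i hi)).2
  have hlim : ∀ i, Tendsto (fun k : ℕ => Ring.inverse (aeval b (bsPoly (c i) (ρ i) k))) atTop
      (𝓝 (if some i = o then 1 else 0)) := by
    intro i
    by_cases hi : o = some i
    · rw [if_pos hi.symm]; exact (bs_poly_in b _ _ (hρ i) (hin i hi)).1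
    · rw [if_neg (Ne.symm hi)]; exact (bs_poly_out b _ _ (hρ i) (hout i hi)).1
  have hprod : ∀ k, (∀ i, IsUnit (aeval b (bsPoly (c i) (ρ i) k))) → ∀ s : Finset (Fin n),
      IsUnit (aeval b (∏ l ∈ s, bsPoly (c l) (ρ l) k)) := by
    intro k hk s
    induction s using Finset.induction_on with
    | empty => simp
    | insert i s his ih => rw [Finset.prod_insert his, map_mul]; exact (hk i).mul ih
  have hsome : ∀ k, (∀ i, IsUnit (aeval b (bsPoly (c i) (ρ i) k))) → ∀ i,
      aeval b (∏ l ∈ Finset.univ.erase i, bsPoly (c l) (ρ l) k) *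
      Ring.inverse (aeval b (∏ l, bsPoly (c l) (ρ l) k)) =
      Ring.inverse (aeval b (bsPoly (c i) (ρ i) k)) := by
    intro k hk i
    rw [← Finset.mul_prod_erase Finset.univ _ (Finset.mem_univ i), map_mul]
    exact bs_cancel _ _ (hk i) (hprod k hk _)
  cases o' with
  | some i =>
    refine (hlim i).congr' ?_
    filter_upwards [hunit] with k hk
    exact (hsome k hk i).symm
  | none =>
    have h1 : Tendsto (fun k : ℕ => 1 - ∑ i, Ring.inverse (aeval b (bsPoly (c i) (ρ i) k))) atTop
        (𝓝 (1 - ∑ i, if some i = o then 1 else 0)) :=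
      tendsto_const_nhds.sub (tendsto_finsetSum _ fun i _ => hlim i)
    have h2 : (1 - ∑ i, if some i = o then 1 else 0 : A) = if none = o then 1 else 0 := by
      cases o with
      | none => simp
      | some j => simp
    rw [h2] at h1
    refine h1.congr' ?_
    filter_upwards [hunit] with k hk
    simp only [bsNum, map_sub, map_sum, sub_mul, Finset.sum_mul]
    rw [Ring.mul_inverse_cancel _ (hprod k hk _)]
    congr 1
    exact Finset.sum_congr rfl fun i _ => (hsome k hk i).symm

end SpectralPart
section TracePart

open Filter Topology

lemma bs_cmt_inner (T : H →L[ℂ] H) (x : H) :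
    (@inner ℂ _ _ (cmt (adjoint T) T x) x) = ((‖T x‖ ^ 2 - ‖adjoint T x‖ ^ 2 : ℝ) : ℂ) := by
  simp only [cmt, sub_apply, mul_apply_eq_comp, inner_sub_left]
  rw [adjoint_inner_left]
  have h : @inner ℂ _ _ (T (adjoint T x)) x = @inner ℂ _ _ (adjoint T x) (adjoint T x) :=
    (adjoint_inner_right T (adjoint T x) x).symm
  rw [h, inner_self_eq_norm_sq_to_K, inner_self_eq_norm_sq_to_K]
  push_cast
  rfl

lemma bs_hypo_of_norm (T : H →L[ℂ] H) (h : ∀ x, ‖adjoint T x‖ ≤ ‖T x‖) : Hyponormal T := by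
  rw [Hyponormal, isPositive_iff]
  have hsym : ((cmt (adjoint T) T : H →L[ℂ] H) : H →ₗ[ℂ] H).IsSymmetric := by
    rw [← ContinuousLinearMap.isSelfAdjoint_iff_isSymmetric]
    rw [ContinuousLinearMap.isSelfAdjoint_iff']
    simp [cmt, ContinuousLinearMap.mul_def, adjoint_comp]
  refine ⟨hsym, fun x => ?_⟩
  rw [bs_cmt_inner]
  have h1 := h x
  have h2 := norm_nonneg (adjoint T x)
  have : 0 ≤ ‖T x‖ ^ 2 - ‖adjoint T x‖ ^ 2 := by nlinarith
  exact_mod_cast this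

lemma bs_sqrt (D : H →L[ℂ] H) (hD : D.IsPositive) :
    ∃ S : H →L[ℂ] H, adjoint S = S ∧ S * S = D := by
  have h0 : 0 ≤ D := (nonneg_iff_isPositive D).2 hD
  refine ⟨CFC.sqrt D, ?_, CFC.sqrt_mul_sqrt_self D h0⟩
  have h1 := (nonneg_iff_isPositive _).1 (CFC.sqrt_nonneg D)
  exact h1.isSelfAdjoint.adjoint_eq

lemma bs_sqrt_norm {D S : H →L[ℂ] H} (h1 : adjoint S = S) (h2 : S * S = D) (x : H) :
    @inner ℂ _ _ (D x) x = ((‖S x‖ ^ 2 : ℝ) : ℂ) := by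
  rw [← h2, mul_apply_eq_comp]
  nth_rewrite 1 [← h1]
  rw [adjoint_inner_left, inner_self_eq_norm_sq_to_K]
  push_cast
  rfl

lemma bs_proj_norm {ι : Type*} [Fintype ι] (V : Submodule ℂ H) [FiniteDimensional ℂ V]
    (u : OrthonormalBasis ι ℂ V) (x : H) :
    ∑ a, ‖@inner ℂ _ _ (u a : H) x‖ ^ 2 = ‖V.starProjection x‖ ^ 2 := by
  have h := u.sum_sq_norm_inner_right (V.orthogonalProjectionOnto x)
  have h' : ‖V.starProjection x‖ = ‖V.orthogonalProjectionOnto x‖ := rfl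
  rw [h', ← h]
  refine Finset.sum_congr rfl fun a _ => ?_
  rw [Submodule.coe_inner, ← Submodule.starProjection_apply,
    ← Submodule.inner_starProjection_left_eq_right,
    Submodule.starProjection_eq_self_iff.2 (u a).2]

lemma bs_trace_fin (T : H →L[ℂ] H) (R : ℝ) (hR : ‖T‖ ≤ R) (m : ℕ) (V : Submodule ℂ H)
    [FiniteDimensional ℂ V] (z : Fin m → H)
    (hz : ∀ x ∈ V, T x ∈ V ⊔ Submodule.span ℂ (Set.range z))
    {ι : Type*} [Fintype ι] (u : OrthonormalBasis ι ℂ V) :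
    ∑ a, (‖T (u a : H)‖ ^ 2 - ‖adjoint T (u a : H)‖ ^ 2) ≤ m * R ^ 2 := by
  set W : Submodule ℂ H := Submodule.span ℂ (Set.range fun l => z l - V.starProjection (z l))
    with hW
  have hu : Orthonormal ℂ (fun a => (u a : H)) :=
    u.orthonormal.comp_linearIsometry V.subtypeₗᵢ
  have : FiniteDimensional ℂ W := FiniteDimensional.span_of_finite ℂ (Set.finite_range _)
  have hWV : W ≤ Vᗮ := by
    rw [hW, Submodule.span_le]
    rintro _ ⟨l, rfl⟩
    exact Submodule.sub_starProjection_mem_orthogonal _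
  have hTW : ∀ x ∈ V, T x - V.starProjection (T x) ∈ W := by
    intro x hx
    obtain ⟨y, hy, w, hw, hyw⟩ := Submodule.mem_sup.1 (hz x hx)
    rw [← hyw, map_add, Submodule.starProjection_eq_self_iff.2 hy, add_sub_add_left_eq_sub]
    clear hyw
    induction hw using Submodule.span_induction with
    | mem w hw =>
      obtain ⟨l, rfl⟩ := hw
      exact Submodule.subset_span ⟨l, rfl⟩
    | zero => simp
    | add a b _ _ ha hb =>
      rw [map_add, add_sub_add_comm]; exact W.add_mem ha hb
    | smul c a _ ha => rw [map_smul, ← smul_sub]; exact W.smul_mem c ha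
  have hrank : Module.finrank ℂ W ≤ m := by
    have := finrank_range_le_card (R := ℂ) (fun l => z l - V.starProjection (z l))
    simpa [Set.finrank] using this
  let w := stdOrthonormalBasis ℂ W
  have h1 : ∀ a, ‖T (u a : H)‖ ^ 2 = ‖V.starProjection (T (u a : H))‖ ^ 2 +
      ∑ l, ‖@inner ℂ _ _ (w l : H) (T (u a : H))‖ ^ 2 := by
    intro a
    rw [Submodule.norm_sq_eq_add_norm_sq_starProjection (T (u a : H)) V]
    congr 1
    have h2 := hTW _ (u a).2
    have h2' : Vᗮ.starProjection (T (u a : H)) = T (u a : H) - V.starProjection (T (u a : H)) := by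
      rw [Submodule.starProjection_orthogonal']; rfl
    rw [h2']
    have h3 := bs_proj_norm W w (T (u a : H) - V.starProjection (T (u a : H)))
    rw [Submodule.starProjection_eq_self_iff.2 h2] at h3
    rw [← h3]
    refine Finset.sum_congr rfl fun l _ => ?_
    rw [inner_sub_right]
    have h4 : @inner ℂ _ _ (w l : H) (V.starProjection (T (u a : H))) = 0 :=
      Submodule.inner_left_of_mem_orthogonal (Submodule.starProjection_apply_mem _ _)
        (hWV (w l).2)
    rw [h4, sub_zero]
  have h2 : ∀ a, ‖V.starProjection (adjoint T (u a : H))‖ ^ 2 ≤ ‖adjoint T (u a : H)‖ ^ 2 := by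
    intro a
    rw [Submodule.norm_sq_eq_add_norm_sq_starProjection (adjoint T (u a : H)) V]
    nlinarith [sq_nonneg ‖Vᗮ.starProjection (adjoint T (u a : H))‖]
  have h3 : ∑ a, ‖V.starProjection (T (u a : H))‖ ^ 2 =
      ∑ a, ‖V.starProjection (adjoint T (u a : H))‖ ^ 2 := by
    simp only [← bs_proj_norm V u]
    rw [Finset.sum_comm]
    refine Finset.sum_congr rfl fun a _ => Finset.sum_congr rfl fun b _ => ?_
    rw [adjoint_inner_right, norm_inner_symm]
  have h4 : ∑ a, ∑ l, ‖@inner ℂ _ _ (w l : H) (T (u a : H))‖ ^ 2 ≤ m * R ^ 2 := by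
    rw [Finset.sum_comm]
    have h5 : ∀ l, ∑ a, ‖@inner ℂ _ _ (w l : H) (T (u a : H))‖ ^ 2 ≤ R ^ 2 := by
      intro l
      have h6 := hu.sum_inner_products_le (adjoint T (w l : H)) (s := Finset.univ)
      have h7 : ‖adjoint T (w l : H)‖ ≤ R := by
        refine (ContinuousLinearMap.le_opNorm _ _).trans ?_
        have : ‖(w l : H)‖ = 1 := w.orthonormal.1 l
        rw [this, mul_one, LinearIsometryEquiv.norm_map]
        exact hR
      have h8 : ‖adjoint T (w l : H)‖ ^ 2 ≤ R ^ 2 := pow_le_pow_left₀ (norm_nonneg _) h7 2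
      refine le_trans (le_of_eq ?_) (h6.trans h8)
      refine Finset.sum_congr rfl fun a _ => ?_
      rw [adjoint_inner_right, norm_inner_symm]
    refine (Finset.sum_le_sum fun l _ => h5 l).trans ?_
    rw [Finset.sum_const, Finset.card_univ, Fintype.card_fin, nsmul_eq_mul]
    exact mul_le_mul_of_nonneg_right (by exact_mod_cast hrank) (sq_nonneg R)
  have h5 : ∑ a, (‖T (u a : H)‖ ^ 2 - ‖adjoint T (u a : H)‖ ^ 2) ≤
      ∑ a, (‖V.starProjection (T (u a : H))‖ ^ 2 - ‖V.starProjection (adjoint T (u a : H))‖ ^ 2 +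
        ∑ l, ‖@inner ℂ _ _ (w l : H) (T (u a : H))‖ ^ 2) := by
    refine Finset.sum_le_sum fun a _ => ?_
    linarith [h1 a, h2 a]
  refine h5.trans ?_
  rw [Finset.sum_add_distrib, Finset.sum_sub_distrib, h3, sub_self, zero_add]
  exact h4

lemma bs_trace (T : H →L[ℂ] H) (hT : Hyponormal T) (R : ℝ) (hR : ‖T‖ ≤ R) (m : ℕ)
    (V : ℕ → Submodule ℂ H) [∀ n, FiniteDimensional ℂ (V n)] (z : ℕ → Fin m → H)
    (hz : ∀ n, ∀ x ∈ V n, T x ∈ V n ⊔ Submodule.span ℂ (Set.range (z n)))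
    (hd : ∀ x, Tendsto (fun n => (V n).starProjection x) atTop (𝓝 x))
    {κ : Type*} [Fintype κ] (e : κ → H) (he : Orthonormal ℂ e) :
    ∑ k, (‖T (e k)‖ ^ 2 - ‖adjoint T (e k)‖ ^ 2) ≤ m * R ^ 2 := by
  obtain ⟨S, hS1, hS2⟩ := bs_sqrt _ hT
  have hS : ∀ x, ‖T x‖ ^ 2 - ‖adjoint T x‖ ^ 2 = ‖S x‖ ^ 2 := by
    intro x
    have h1 := bs_sqrt_norm hS1 hS2 x
    rw [bs_cmt_inner] at h1
    exact_mod_cast h1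
  have h1 : ∀ n, ∑ k, ‖(V n).starProjection (S (e k))‖ ^ 2 ≤ m * R ^ 2 := by
    intro n
    let u := stdOrthonormalBasis ℂ (V n)
    refine le_trans ?_ (bs_trace_fin T R hR m (V n) (z n) (hz n) u)
    simp only [hS, ← bs_proj_norm (V n) u]
    rw [Finset.sum_comm]
    refine Finset.sum_le_sum fun a _ => ?_
    refine le_trans (le_of_eq ?_) (he.sum_inner_products_le (S (u a : H)) (s := Finset.univ))
    refine Finset.sum_congr rfl fun k _ => ?_
    nth_rewrite 1 [← hS1]
    rw [adjoint_inner_right, norm_inner_symm]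
  have h2 : Tendsto (fun n => ∑ k, ‖(V n).starProjection (S (e k))‖ ^ 2) atTop
      (𝓝 (∑ k, ‖S (e k)‖ ^ 2)) :=
    tendsto_finsetSum _ fun k _ => ((hd (S (e k))).norm.pow 2)
  simp only [hS]
  exact le_of_tendsto' h2 h1

/-- Strong convergence of the projections from approximation of a total set. -/
lemma bs_proj_tendsto (V : ℕ → Submodule ℂ H) [∀ n, FiniteDimensional ℂ (V n)] (G : Set H)
    (hG : Dense ((Submodule.span ℂ G : Submodule ℂ H) : Set H))
    (h : ∀ g ∈ G, ∃ y : ℕ → H, (∀ᶠ n in atTop, y n ∈ V n) ∧ Tendsto y atTop (𝓝 g)) (x : H) :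
    Tendsto (fun n => (V n).starProjection x) atTop (𝓝 x) := by
  have hnorm : ∀ n (x : H), ‖(V n).starProjection x‖ ≤ ‖x‖ := fun n x => by
    have := (V n).starProjection.le_of_opNorm_le (Submodule.starProjection_norm_le (V n)) x
    simpa using this
  have hspan : ∀ s ∈ Submodule.span ℂ G,
      Tendsto (fun n => (V n).starProjection s) atTop (𝓝 s) := by
    intro s hs
    induction hs using Submodule.span_induction with
    | mem g hg =>
      obtain ⟨y, hy1, hy2⟩ := h g hg
      have h1 : Tendsto (fun n => y n + (V n).starProjection (g - y n)) atTop (𝓝 (g + 0)) := by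
        refine hy2.add ?_
        have h2 : Tendsto (fun n => ‖g - y n‖) atTop (𝓝 0) := by
          have := (tendsto_const_nhds (x := g)).sub hy2
          simpa using this.norm
        exact squeeze_zero_norm (fun n => hnorm n _) h2
      rw [add_zero] at h1
      refine h1.congr' ?_
      filter_upwards [hy1] with n hn
      rw [map_sub, Submodule.starProjection_eq_self_iff.2 hn]
      abel
    | zero => simp
    | add a b _ _ ha hb => simpa using ha.add hb
    | smul c a _ ha => simpa using ha.const_smul c
  rw [Metric.tendsto_atTop]
  intro ε hε
  obtain ⟨s, hs1, hs2⟩ := Metric.mem_closure_iff.1 (hG x) (ε / 3) (by positivity)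
  obtain ⟨N, hN⟩ := Metric.tendsto_atTop.1 (hspan s hs1) (ε / 3) (by positivity)
  refine ⟨N, fun n hn => ?_⟩
  have h1 := hN n hn
  have h2 := hnorm n (x - s)
  rw [dist_eq_norm] at h1 hs2 ⊢
  have h3 : (V n).starProjection x - x =
      (V n).starProjection (x - s) + ((V n).starProjection s - s) - (x - s) := by
    rw [map_sub]; abel
  rw [h3]
  calc _ ≤ ‖(V n).starProjection (x - s)‖ + ‖(V n).starProjection s - s‖ + ‖x - s‖ :=
        (norm_sub_le _ _).trans (add_le_add_left (norm_add_le _ _) _)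
    _ < ε := by linarith

end TracePart
section DiagPart

open Filter Topology Polynomial

variable {ι : Type*} [Fintype ι] [DecidableEq ι] {G : ι → Type*}
  [∀ i, NormedAddCommGroup (G i)] [∀ i, InnerProductSpace ℂ (G i)] [∀ i, CompleteSpace (G i)]

/-- The diagonal operator on a finite Hilbert sum. -/
def bsDiag (B : ∀ i, G i →L[ℂ] G i) : PiLp 2 G →L[ℂ] PiLp 2 G :=
  ((PiLp.continuousLinearEquiv 2 ℂ G).symm : (∀ i, G i) →L[ℂ] PiLp 2 G) ∘L
    (ContinuousLinearMap.pi fun i => B i ∘L ContinuousLinearMap.proj i) ∘L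
      ((PiLp.continuousLinearEquiv 2 ℂ G) : PiLp 2 G →L[ℂ] (∀ i, G i))

lemma bsDiag_apply (B : ∀ i, G i →L[ℂ] G i) (x : PiLp 2 G) (i : ι) :
    (bsDiag B x) i = B i (x i) := rfl

/-- The inclusion of a summand in a finite Hilbert sum. -/
def bsSingle (i : ι) : G i →L[ℂ] PiLp 2 G :=
  ((PiLp.continuousLinearEquiv 2 ℂ G).symm : (∀ i, G i) →L[ℂ] PiLp 2 G) ∘L
    (ContinuousLinearMap.single ℂ G i)

lemma bsSingle_apply (i : ι) (x : G i) (j : ι) :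
    (bsSingle i x : PiLp 2 G) j = (Pi.single i x : ∀ i, G i) j := rfl

lemma bsSingle_inner (i j : ι) (x : G i) (y : G j) :
    @inner ℂ _ _ (bsSingle i x : PiLp 2 G) (bsSingle j y) =
      @inner ℂ _ _ ((Pi.single i x : ∀ i, G i) j) y := by
  rw [PiLp.inner_apply, Finset.sum_eq_single j]
  · rw [bsSingle_apply, bsSingle_apply, Pi.single_eq_same]
  · intro k _ hk
    rw [bsSingle_apply, bsSingle_apply, Pi.single_eq_of_ne hk, inner_zero_right]
  · simp

lemma bsSingle_norm (i : ι) (x : G i) : ‖(bsSingle i x : PiLp 2 G)‖ = ‖x‖ := by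
  have h := bsSingle_inner i i x x
  rw [Pi.single_eq_same, inner_self_eq_norm_sq_to_K, inner_self_eq_norm_sq_to_K] at h
  have h2 : ‖(bsSingle i x : PiLp 2 G)‖ ^ 2 = ‖x‖ ^ 2 := by exact_mod_cast h
  exact (pow_left_inj₀ (norm_nonneg _) (norm_nonneg _) two_ne_zero).1 h2

lemma bsDiag_single (B : ∀ i, G i →L[ℂ] G i) (i : ι) (x : G i) :
    bsDiag B (bsSingle i x) = bsSingle i (B i x) := by
  ext j
  rw [bsDiag_apply, bsSingle_apply, bsSingle_apply]
  by_cases h : j = i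
  · subst h; simp
  · simp [Pi.single_eq_of_ne h]

lemma bsDiag_adjoint (B : ∀ i, G i →L[ℂ] G i) :
    adjoint (bsDiag B) = bsDiag (fun i => adjoint (B i)) := by
  symm
  rw [eq_adjoint_iff]
  intro x y
  rw [PiLp.inner_apply, PiLp.inner_apply]
  refine Finset.sum_congr rfl fun i _ => ?_
  rw [bsDiag_apply, bsDiag_apply, adjoint_inner_left]

lemma bsDiag_norm (B : ∀ i, G i →L[ℂ] G i) (R : ℝ) (hR0 : 0 ≤ R) (hR : ∀ i, ‖B i‖ ≤ R) :
    ‖bsDiag B‖ ≤ R := by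
  refine ContinuousLinearMap.opNorm_le_bound _ hR0 fun x => ?_
  refine (pow_le_pow_iff_left₀ (norm_nonneg _) (by positivity) two_ne_zero).1 ?_
  rw [mul_pow, PiLp.norm_sq_eq_of_L2, PiLp.norm_sq_eq_of_L2, Finset.mul_sum]
  refine Finset.sum_le_sum fun i _ => ?_
  rw [← mul_pow, bsDiag_apply]
  exact pow_le_pow_left₀ (norm_nonneg _) ((B i).le_of_opNorm_le (hR i) _) 2

lemma bsDiag_aeval (B : ∀ i, G i →L[ℂ] G i) (p : ℂ[X]) (x : PiLp 2 G) (i : ι) :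
    (aeval (bsDiag B) p x) i = aeval (B i) p (x i) := by
  induction p using Polynomial.induction_on' generalizing x with
  | add p q hp hq => simp only [map_add, add_apply, PiLp.add_apply, hp, hq]
  | monomial n a =>
    have hpow : ∀ (n : ℕ) (x : PiLp 2 G), (((bsDiag B) ^ n) x) i = ((B i) ^ n) (x i) := by
      intro n
      induction n with
      | zero => intro x; simp
      | succ n ih => intro x; rw [pow_succ, pow_succ, mul_apply_eq_comp, mul_apply_eq_comp, ih]; rfl
    rw [← C_mul_X_pow_eq_monomial]
    simp only [map_mul, aeval_C, map_pow, aeval_X, ← Algebra.smul_def, smul_apply,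
      PiLp.smul_apply, hpow]

lemma bs_dense_single (F : ∀ i, Set (G i))
    (hF : ∀ i, Dense ((Submodule.span ℂ (F i) : Submodule ℂ (G i)) : Set (G i))) :
    Dense ((Submodule.span ℂ {z : PiLp 2 G | ∃ i, ∃ x ∈ F i, z = bsSingle i x} :
      Submodule ℂ (PiLp 2 G)) : Set (PiLp 2 G)) := by
  set S := Submodule.span ℂ {z : PiLp 2 G | ∃ i, ∃ x ∈ F i, z = bsSingle i x} with hS
  have h1 : ∀ i (x : G i), bsSingle i x ∈ S.topologicalClosure := by
    intro i x
    have hmap : ∀ y ∈ Submodule.span ℂ (F i), (bsSingle i y : PiLp 2 G) ∈ S := by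
      intro y hy
      induction hy using Submodule.span_induction with
      | mem y hy => exact Submodule.subset_span ⟨i, y, hy, rfl⟩
      | zero => rw [map_zero]; exact S.zero_mem
      | add a b _ _ ha hb => rw [map_add]; exact S.add_mem ha hb
      | smul c a _ ha => rw [map_smul]; exact S.smul_mem c ha
    exact map_mem_closure (bsSingle i).continuous (hF i x) hmap
  have h2 : ∀ x : PiLp 2 G, x = ∑ i, bsSingle i (x i) := by
    intro x
    ext j
    rw [WithLp.ofLp_sum, Finset.sum_apply, Finset.sum_eq_single j]
    · rw [bsSingle_apply, Pi.single_eq_same]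
    · intro k _ hk
      rw [bsSingle_apply, Pi.single_eq_of_ne (Ne.symm hk)]
    · simp
  intro x
  have : x ∈ S.topologicalClosure := by
    rw [h2 x]
    exact Submodule.sum_mem _ fun i _ => h1 i _
  exact this

lemma bs_diag_main (B : ∀ i, G i →L[ℂ] G i) (hB : ∀ i x, ‖adjoint (B i) x‖ ≤ ‖B i x‖)
    (R : ℝ) (hR0 : 0 ≤ R) (hR : ∀ i, ‖B i‖ ≤ R) (m : ℕ) (v : ∀ i, Fin m → G i)
    (hv : ∀ i, Dense ((Submodule.span ℂ {x | ∃ (j : Fin m) (k : ℕ), x = (B i ^ k) (v i j)} :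
      Submodule ℂ (G i)) : Set (G i)))
    (a : ℕ → ι → ℂ[X]) (Q : ℕ → ∀ i, G i →L[ℂ] G i)
    (hQ : ∀ i i', Tendsto (fun n => aeval (B i') (a n i) * Q n i') atTop
      (𝓝 (if i = i' then 1 else 0)))
    (κ : ι → Type*) [∀ i, Fintype (κ i)] (e : ∀ i, κ i → G i) (he : ∀ i, Orthonormal ℂ (e i)) :
    ∑ i, ∑ k, (‖B i (e i k)‖ ^ 2 - ‖adjoint (B i) (e i k)‖ ^ 2) ≤ m * R ^ 2 := by
  classical
  set T := bsDiag B with hTdef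
  let p : ℕ → Fin m → PiLp 2 G := fun n j => bsDiag (Q n) (WithLp.toLp 2 fun i => v i j)
  have hp : ∀ n j i, (p n j) i = Q n i (v i j) := fun n j i => rfl
  let M : ℕ → ℕ := fun n => n + (∑ i, (a n i).natDegree) + 1
  let V : ℕ → Submodule ℂ (PiLp 2 G) := fun n =>
    Submodule.span ℂ (Set.range fun kj : Fin (M n) × Fin m => (T ^ (kj.1 : ℕ)) (p n kj.2))
  have hfin : ∀ n, FiniteDimensional ℂ (V n) := fun n =>
    FiniteDimensional.span_of_finite ℂ (Set.finite_range _)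
  have hT : Hyponormal T := by
    apply bs_hypo_of_norm
    intro x
    refine (pow_le_pow_iff_left₀ (norm_nonneg _) (norm_nonneg _) two_ne_zero).1 ?_
    rw [PiLp.norm_sq_eq_of_L2, PiLp.norm_sq_eq_of_L2, hTdef, bsDiag_adjoint]
    refine Finset.sum_le_sum fun i _ => ?_
    exact pow_le_pow_left₀ (norm_nonneg _) (hB i _) 2
  have hz : ∀ n, ∀ x ∈ V n,
      T x ∈ V n ⊔ Submodule.span ℂ (Set.range fun j => (T ^ (M n)) (p n j)) := by
    intro n x hx
    induction hx using Submodule.span_induction with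
    | mem x hx =>
      obtain ⟨⟨k, j⟩, rfl⟩ := hx
      simp only
      rw [← mul_apply_eq_comp, ← pow_succ']
      by_cases hk : (k : ℕ) + 1 < M n
      · exact Submodule.mem_sup_left (Submodule.subset_span ⟨(⟨(k : ℕ) + 1, hk⟩, j), rfl⟩)
      · have : (k : ℕ) + 1 = M n := le_antisymm k.2 (not_lt.1 hk)
        rw [this]
        exact Submodule.mem_sup_right (Submodule.subset_span ⟨j, rfl⟩)
    | zero => rw [map_zero]; exact Submodule.zero_mem _
    | add a b _ _ ha hb => rw [map_add]; exact Submodule.add_mem _ ha hb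
    | smul c a _ ha => rw [map_smul]; exact Submodule.smul_mem _ c ha
  have hpoly : ∀ n (q : ℂ[X]) (j : Fin m), q.natDegree < M n → aeval T q (p n j) ∈ V n := by
    intro n q j hq
    rw [aeval_eq_sum_range' hq, sum_apply]
    refine Submodule.sum_mem _ fun k hk => ?_
    rw [smul_apply]
    exact Submodule.smul_mem _ _
      (Submodule.subset_span ⟨(⟨k, Finset.mem_range.1 hk⟩, j), rfl⟩)
  have hd : ∀ x, Tendsto (fun n => (V n).starProjection x) atTop (𝓝 x) := by
    refine bs_proj_tendsto V _ (bs_dense_single _ hv) ?_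
    rintro g ⟨i, x, ⟨j, k, rfl⟩, rfl⟩
    refine ⟨fun n => aeval T (X ^ k * a n i) (p n j), ?_, ?_⟩
    · filter_upwards [eventually_ge_atTop k] with n hn
      apply hpoly
      have h1 : (X ^ k * a n i).natDegree ≤ k + (a n i).natDegree := by
        refine natDegree_mul_le.trans ?_
        rw [natDegree_X_pow]
      have h2 : (a n i).natDegree ≤ ∑ i, (a n i).natDegree :=
        Finset.single_le_sum (f := fun i => (a n i).natDegree) (fun _ _ => Nat.zero_le _)
          (Finset.mem_univ i)
      simp only [M]
      omega
    · have hcomp : ∀ i', Tendsto (fun n => (aeval T (X ^ k * a n i) (p n j)) i') atTop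
          (𝓝 ((bsSingle i ((B i ^ k) (v i j)) : PiLp 2 G) i')) := by
        intro i'
        have h1 : ∀ n, (aeval T (X ^ k * a n i) (p n j)) i' =
            (B i' ^ k) ((aeval (B i') (a n i) * Q n i') (v i' j)) := by
          intro n
          rw [hTdef, bsDiag_aeval, hp, map_mul, map_pow, aeval_X]
          rfl
        simp only [h1]
        have h2 : Tendsto (fun n => (aeval (B i') (a n i) * Q n i') (v i' j)) atTop
            (𝓝 ((if i = i' then 1 else 0 : G i' →L[ℂ] G i') (v i' j))) :=
          ((ContinuousLinearMap.apply ℂ (G i') (v i' j)).continuous.tendsto _).comp (hQ i i')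
        have h3 := ((B i' ^ k).continuous.tendsto _).comp h2
        have h4 : (bsSingle i ((B i ^ k) (v i j)) : PiLp 2 G) i' =
            (B i' ^ k) ((if i = i' then 1 else 0 : G i' →L[ℂ] G i') (v i' j)) := by
          rw [bsSingle_apply]
          by_cases h : i = i'
          · subst h; simp
          · rw [Pi.single_eq_of_ne (Ne.symm h), if_neg h]; simp
        rw [h4]
        exact h3
      have h5 : Tendsto (fun n => WithLp.ofLp (aeval T (X ^ k * a n i) (p n j))) atTop
          (𝓝 (WithLp.ofLp (bsSingle i ((B i ^ k) (v i j)) : PiLp 2 G))) :=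
        tendsto_pi_nhds.2 hcomp
      exact ((PiLp.continuousLinearEquiv 2 ℂ G).symm.continuous.tendsto _).comp h5
  have he' : Orthonormal ℂ (fun s : Σ i, κ i => (bsSingle s.1 (e s.1 s.2) : PiLp 2 G)) := by
    rw [orthonormal_iff_ite]
    rintro ⟨i, k⟩ ⟨j, l⟩
    rw [bsSingle_inner]
    by_cases h : j = i
    · subst h
      rw [Pi.single_eq_same, orthonormal_iff_ite.1 (he j)]
      simp
    · rw [Pi.single_eq_of_ne h, inner_zero_left, if_neg]
      intro h'
      exact h (congrArg Sigma.fst h').symm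
  have hfinal := bs_trace T hT R (bsDiag_norm B R hR0 hR) m V _ hz hd _ he'
  rw [Fintype.sum_sigma] at hfinal
  simpa only [hTdef, bsDiag_adjoint, bsDiag_single, bsSingle_norm] using hfinal

end DiagPart
section ShiftPart

open Filter Topology Polynomial

universe u

/-- The index type of the unilateral shift of multiplicity `m`. -/
abbrev bsIdx (m : ℕ) : Type u := ULift.{u} (Fin m × ℕ)

/-- The model space of the unilateral shift of multiplicity `m`. -/
abbrev bsL (m : ℕ) : Type u := lp (fun _ : bsIdx.{u} m => ℂ) 2

/-- The standard Hilbert basis. -/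
def bsHB (m : ℕ) : HilbertBasis (bsIdx.{u} m) ℂ (bsL.{u} m) := ⟨LinearIsometryEquiv.refl ℂ _⟩

/-- The shift on indices. -/
def bsSh (m : ℕ) (i : bsIdx.{u} m) : bsIdx.{u} m := ⟨(i.down.1, i.down.2 + 1)⟩

lemma bsSh_inj (m : ℕ) : Function.Injective (bsSh.{u} m) := by
  rintro ⟨⟨a, b⟩⟩ ⟨⟨c, d⟩⟩ h
  simp only [bsSh, ULift.up.injEq, Prod.mk.injEq] at h
  obtain ⟨h1, h2⟩ := h
  have : b = d := by omega
  subst h1; subst this; rfl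

lemma bs_shift_exists (m : ℕ) : ∃ U : bsL.{u} m →L[ℂ] bsL.{u} m, (∀ x, ‖U x‖ = ‖x‖) ∧
    ∀ i, U (bsHB m i) = bsHB m (bsSh m i) := by
  have ho : Orthonormal ℂ (fun i => bsHB.{u} m (bsSh m i)) :=
    (bsHB m).orthonormal.comp _ (bsSh_inj m)
  let V : bsL.{u} m →ₗᵢ[ℂ] bsL.{u} m := ho.orthogonalFamily.linearIsometry
  refine ⟨V.toContinuousLinearMap, fun x => V.norm_map x, fun i => ?_⟩
  have h1 : bsHB.{u} m i = lp.single 2 i (1 : ℂ) := by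
    have := (bsHB.{u} m).repr_symm_single i
    rw [← this]; rfl
  show V (bsHB m i) = _
  rw [h1]
  have h2 := ho.orthogonalFamily.linearIsometry_apply_single (i := i) (1 : ℂ)
  exact h2.trans (by simp)

/-- The shift. -/
def bsU (m : ℕ) : bsL.{u} m →L[ℂ] bsL.{u} m := (bs_shift_exists m).choose

lemma bsU_norm (m : ℕ) (x : bsL.{u} m) : ‖bsU m x‖ = ‖x‖ := (bs_shift_exists m).choose_spec.1 x

lemma bsU_basis (m : ℕ) (i : bsIdx.{u} m) : bsU m (bsHB m i) = bsHB m (bsSh m i) :=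
  (bs_shift_exists m).choose_spec.2 i

/-- The cyclic vectors of the shift. -/
def bsE (m : ℕ) (j : Fin m) : bsL.{u} m := bsHB m ⟨(j, 0)⟩

lemma bsE_orthonormal (m : ℕ) : Orthonormal ℂ (bsE.{u} m) := by
  refine (bsHB m).orthonormal.comp (fun j : Fin m => (⟨(j, 0)⟩ : bsIdx.{u} m)) ?_
  intro a b h
  simpa using h

lemma bsU_pow (m : ℕ) (j : Fin m) (k : ℕ) : ((bsU.{u} m) ^ k) (bsE m j) = bsHB m ⟨(j, k)⟩ := by
  induction k with
  | zero => rfl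
  | succ k ih => rw [pow_succ', mul_apply_eq_comp, ih, bsU_basis]; rfl

lemma bsU_adj (m : ℕ) (j : Fin m) : adjoint (bsU.{u} m) (bsE m j) = 0 := by
  have h : ∀ i, @inner ℂ _ _ (bsHB.{u} m i) (adjoint (bsU.{u} m) (bsE m j)) = 0 := by
    intro i
    rw [adjoint_inner_right, bsU_basis]
    refine (bsHB m).orthonormal.2 ?_
    intro h
    have := congrArg (fun t : bsIdx.{u} m => t.down.2) h
    simp [bsSh] at this
  have h2 := (bsHB.{u} m).hasSum_repr (adjoint (bsU.{u} m) (bsE m j))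
  have h3 : ∀ i, (bsHB.{u} m).repr (adjoint (bsU.{u} m) (bsE m j)) i • bsHB.{u} m i = 0 := by
    intro i
    rw [HilbertBasis.repr_apply_apply, h, zero_smul]
  simp only [h3] at h2
  exact h2.unique hasSum_zero

lemma bsU_star_mul (m : ℕ) : adjoint (bsU.{u} m) * bsU m = 1 := by
  have h := (ContinuousLinearMap.norm_map_iff_adjoint_comp_self (bsU.{u} m)).1 (bsU_norm m)
  exact h

/-- `c + r U`. -/
def bsB (m : ℕ) (c : ℂ) (r : ℝ) : bsL.{u} m →L[ℂ] bsL.{u} m := c • 1 + (r : ℂ) • bsU m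

lemma bsU_norm_adj (m : ℕ) (x : bsL.{u} m) : ‖adjoint (bsU m) x‖ ≤ ‖x‖ := by
  have h1 : ‖bsU.{u} m‖ ≤ 1 := opNorm_le_bound _ zero_le_one fun x => by rw [bsU_norm, one_mul]
  have h2 : ‖adjoint (bsU.{u} m)‖ ≤ 1 := by rw [LinearIsometryEquiv.norm_map]; exact h1
  simpa using le_of_opNorm_le _ h2 x

lemma bsB_diff (m : ℕ) (c : ℂ) (r : ℝ) (x : bsL.{u} m) :
    ‖bsB m c r x‖ ^ 2 - ‖adjoint (bsB m c r) x‖ ^ 2 =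
      r ^ 2 * (‖x‖ ^ 2 - ‖adjoint (bsU m) x‖ ^ 2) := by
  have h1 : bsB m c r x = c • x + (r : ℂ) • bsU m x := rfl
  have h2 : adjoint (bsB m c r) x = (starRingEnd ℂ c) • x + (r : ℂ) • adjoint (bsU m) x := by
    simp only [bsB, map_add, map_smulₛₗ, Complex.conj_ofReal, add_apply, smul_apply]
    congr 2
    have : adjoint (1 : bsL.{u} m →L[ℂ] bsL.{u} m) = 1 := star_one _
    rw [this]; rfl
  have h4 : @inner ℂ _ _ ((starRingEnd ℂ c) • x) ((r : ℂ) • adjoint (bsU m) x) =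
      (r : ℂ) * (c * @inner ℂ _ _ (bsU m x) x) := by
    rw [inner_smul_left, inner_smul_right, adjoint_inner_right, Complex.conj_conj]; ring
  have h5 : @inner ℂ _ _ (c • x) ((r : ℂ) • bsU m x) =
      (r : ℂ) * ((starRingEnd ℂ) c * @inner ℂ _ _ x (bsU m x)) := by
    rw [inner_smul_left, inner_smul_right]; ring
  rw [h1, h2, @norm_add_sq ℂ, @norm_add_sq ℂ, h4, h5]
  simp only [norm_smul, bsU_norm,
    RCLike.norm_conj, mul_pow, Complex.norm_real, Real.norm_eq_abs, sq_abs]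
  have h3 : RCLike.re ((r : ℂ) * ((starRingEnd ℂ) c * @inner ℂ _ _ x (bsU m x))) =
      RCLike.re ((r : ℂ) * (c * @inner ℂ _ _ (bsU m x) x)) := by
    rw [← inner_conj_symm x]
    rw [← RCLike.conj_re]
    simp
  rw [h3]; ring

lemma bsB_hypo (m : ℕ) (c : ℂ) (r : ℝ) (x : bsL.{u} m) :
    ‖adjoint (bsB m c r) x‖ ≤ ‖bsB m c r x‖ := by
  have h := bsB_diff m c r x
  have h1 := bsU_norm_adj m x
  have h2 : ‖adjoint (bsU m) x‖ ^ 2 ≤ ‖x‖ ^ 2 := pow_le_pow_left₀ (norm_nonneg _) h1 2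
  refine (pow_le_pow_iff_left₀ (norm_nonneg _) (norm_nonneg _) two_ne_zero).1 ?_
  nlinarith [mul_nonneg (sq_nonneg r) (sub_nonneg.2 h2)]

lemma bsB_diff_E (m : ℕ) (c : ℂ) (r : ℝ) (j : Fin m) :
    ‖bsB m c r (bsE.{u} m j)‖ ^ 2 - ‖adjoint (bsB m c r) (bsE.{u} m j)‖ ^ 2 = r ^ 2 := by
  rw [bsB_diff, bsU_adj, (bsE_orthonormal m).1]; simp

lemma bsU_opNorm (m : ℕ) : ‖bsU.{u} m‖ ≤ 1 :=
  opNorm_le_bound _ zero_le_one fun x => by rw [bsU_norm, one_mul]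

lemma bsB_norm (m : ℕ) (c : ℂ) (r : ℝ) (hr : 0 ≤ r) : ‖bsB.{u} m c r‖ ≤ ‖c‖ + r := by
  refine opNorm_le_bound _ (by positivity) fun x => ?_
  have h1 : bsB m c r x = c • x + (r : ℂ) • bsU m x := rfl
  rw [h1]
  refine (norm_add_le _ _).trans ?_
  rw [norm_smul, norm_smul, bsU_norm, Complex.norm_real, Real.norm_of_nonneg hr, add_mul]

lemma bsB_dense (m : ℕ) (c : ℂ) (r : ℝ) (hr : 0 < r) :
    Dense ((Submodule.span ℂ {x | ∃ (j : Fin m) (k : ℕ), x = ((bsB.{u} m c r) ^ k) (bsE m j)} :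
      Submodule ℂ (bsL.{u} m)) : Set (bsL.{u} m)) := by
  set S := Submodule.span ℂ {x | ∃ (j : Fin m) (k : ℕ), x = ((bsB.{u} m c r) ^ k) (bsE m j)}
  have hinv : ∀ x ∈ S, bsB m c r x ∈ S := by
    intro x hx
    induction hx using Submodule.span_induction with
    | mem x hx =>
      obtain ⟨j, k, rfl⟩ := hx
      refine Submodule.subset_span ⟨j, k + 1, ?_⟩
      rw [pow_succ', mul_apply_eq_comp]
    | zero => simp
    | add x y _ _ hx hy => rw [map_add]; exact S.add_mem hx hy
    | smul a x _ hx => rw [map_smul]; exact S.smul_mem _ hx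
  have hU : ∀ x ∈ S, bsU m x ∈ S := by
    intro x hx
    have h1 : bsB m c r x = c • x + (r : ℂ) • bsU m x := rfl
    have h2 : bsU m x = (r : ℂ)⁻¹ • (bsB m c r x - c • x) := by
      rw [h1, add_sub_cancel_left, smul_smul, inv_mul_cancel₀ (by exact_mod_cast hr.ne'), one_smul]
    rw [h2]
    exact S.smul_mem _ (S.sub_mem (hinv x hx) (S.smul_mem _ hx))
  have hpow : ∀ k j, ((bsU.{u} m) ^ k) (bsE m j) ∈ S := by
    intro k j
    induction k with
    | zero => exact Submodule.subset_span ⟨j, 0, rfl⟩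
    | succ k ih => rw [pow_succ', mul_apply_eq_comp]; exact hU _ ih
  have hle : Submodule.span ℂ (Set.range (bsHB.{u} m)) ≤ S := by
    rw [Submodule.span_le]
    rintro _ ⟨⟨j, k⟩, rfl⟩
    rw [← bsU_pow]
    exact hpow k j
  have hd := (bsHB.{u} m).dense_span
  have hd2 : Dense ((Submodule.span ℂ (Set.range (bsHB.{u} m)) : Submodule ℂ (bsL.{u} m)) :
    Set (bsL.{u} m)) := Submodule.dense_iff_topologicalClosure_eq_top.2 hd
  exact hd2.mono hle

lemma bs_spec_ball (U : H →L[ℂ] H) (hU : ‖U‖ ≤ 1) (c : ℂ) (r : ℝ) (hr : 0 < r) :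
    spectrum ℂ (c • (1 : H →L[ℂ] H) + (r : ℂ) • U) ⊆ Metric.closedBall c r := by
  intro z hz
  rw [mem_closedBall_iff_norm]
  by_contra hlt
  push Not at hlt
  have hne : z - c ≠ 0 := by
    intro h; rw [h, norm_zero] at hlt; linarith
  have hbound : ‖((r : ℂ) / (z - c)) • U‖ < 1 := by
    rw [norm_smul, norm_div, Complex.norm_real, Real.norm_of_nonneg hr.le]
    have : r / ‖z - c‖ < 1 := (div_lt_one (by linarith)).2 hlt
    calc r / ‖z - c‖ * ‖U‖ ≤ r / ‖z - c‖ * 1 := by gcongr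
      _ < 1 := by rwa [mul_one]
  have hunit : IsUnit (1 - ((r : ℂ) / (z - c)) • U) := isUnit_one_sub_of_norm_lt_one hbound
  refine hz ?_
  have : (algebraMap ℂ (H →L[ℂ] H)) z - (c • (1 : H →L[ℂ] H) + (r : ℂ) • U) =
      (z - c) • (1 - ((r : ℂ) / (z - c)) • U) := by
    rw [Algebra.algebraMap_eq_smul_one, smul_sub, smul_smul, mul_div_cancel₀ _ hne, sub_smul]
    abel
  rw [spectrum.mem_resolventSet_iff, this]
  exact hunit.smul (Units.mk0 (z - c) hne)

lemma bsB_spec (m : ℕ) (c : ℂ) (r : ℝ) (hr : 0 < r) :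
    spectrum ℂ (bsB.{u} m c r) ⊆ Metric.closedBall c r :=
  bs_spec_ball _ (bsU_opNorm m) c r hr

end ShiftPart
section DiscPart

open Filter Topology Polynomial

universe u

variable {E : Type u} [NormedAddCommGroup E] [InnerProductSpace ℂ E] [CompleteSpace E]

/-- The family of spaces used in the disc inequality. -/
def bsFam (E : Type u) (m n : ℕ) : Option (Fin n) → Type u
  | none => E
  | some _ => bsL.{u} m

instance bsFamI1 (m n : ℕ) : ∀ o, NormedAddCommGroup (bsFam E m n o)
  | none => inferInstanceAs (NormedAddCommGroup E)
  | some _ => inferInstanceAs (NormedAddCommGroup (bsL.{u} m))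

instance bsFamI2 (m n : ℕ) : ∀ o, InnerProductSpace ℂ (bsFam E m n o)
  | none => inferInstanceAs (InnerProductSpace ℂ E)
  | some _ => inferInstanceAs (InnerProductSpace ℂ (bsL.{u} m))

instance bsFamI3 (m n : ℕ) : ∀ o, CompleteSpace (bsFam E m n o)
  | none => inferInstanceAs (CompleteSpace E)
  | some _ => inferInstanceAs (CompleteSpace (bsL.{u} m))

/-- The family of operators used in the disc inequality. -/
def bsOp (T : E →L[ℂ] E) (m n : ℕ) (c : Fin n → ℂ) (r : Fin n → ℝ) :
    ∀ o, bsFam E m n o →L[ℂ] bsFam E m n o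
  | none => T
  | some i => bsB.{u} m (c i) (r i)

/-- The family of cyclic vectors. -/
def bsV (m n : ℕ) (v : Fin m → E) : ∀ o, Fin m → bsFam E m n o
  | none => v
  | some _ => bsE.{u} m

/-- The sizes. -/
def bsSz (m n N : ℕ) : Option (Fin n) → ℕ
  | none => N
  | some _ => m

/-- The orthonormal families. -/
def bsOn (m n N : ℕ) (f : Fin N → E) : ∀ o, Fin (bsSz m n N o) → bsFam E m n o
  | none => f
  | some _ => bsE.{u} m

lemma bs_disc_theta (T : E →L[ℂ] E) (hT : ∀ x, ‖adjoint T x‖ ≤ ‖T x‖) (m : ℕ) (v : Fin m → E)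
    (hv : Dense ((Submodule.span ℂ {x | ∃ (j : Fin m) (k : ℕ), x = (T ^ k) (v j)} :
      Submodule ℂ E) : Set E))
    (R : ℝ) (hR : ‖T‖ ≤ R) {n : ℕ} (c : Fin n → ℂ) (ρ : Fin n → ℝ) (hρ : ∀ i, 0 < ρ i)
    (hdis : ∀ i j, i ≠ j → Disjoint (Metric.closedBall (c i) (ρ i)) (Metric.closedBall (c j) (ρ j)))
    (hsp : ∀ i, Disjoint (spectrum ℂ T) (Metric.closedBall (c i) (ρ i)))
    (hcR : ∀ i, ‖c i‖ + ρ i ≤ R) (θ : ℝ) (h0 : 0 < θ) (h1 : θ < 1)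
    {N : ℕ} (f : Fin N → E) (hf : Orthonormal ℂ f) :
    ∑ k, (‖T (f k)‖ ^ 2 - ‖adjoint T (f k)‖ ^ 2) + m * θ ^ 2 * ∑ i, ρ i ^ 2 ≤ m * R ^ 2 := by
  have hR0 : 0 ≤ R := (norm_nonneg _).trans hR
  have hr : ∀ i, 0 < θ * ρ i := fun i => mul_pos h0 (hρ i)
  have hlt : ∀ i, θ * ρ i < ρ i := fun i => by nlinarith [hρ i]
  set r : Fin n → ℝ := fun i => θ * ρ i with hrdef
  have key := bs_diag_main (G := bsFam E m n) (bsOp T m n c r)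
    (by
      rintro (_ | i) x
      · exact hT x
      · exact bsB_hypo m (c i) (r i) x)
    R hR0
    (by
      rintro (_ | i)
      · exact hR
      · exact (bsB_norm m (c i) (r i) (hr i).le).trans (by have := hlt i; have := hcR i; linarith))
    m (bsV m n v)
    (by
      rintro (_ | i)
      · exact hv
      · exact bsB_dense m (c i) (r i) (hr i))
    (fun k => bsNum c ρ k)
    (fun k o => Ring.inverse (aeval (bsOp T m n c r o) (∏ l, bsPoly (c l) (ρ l) k)))
    (by
      intro o' o
      refine bs_num_tendsto (bsOp T m n c r o) c ρ hρ o ?_ ?_ o'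
      · rintro i rfl
        refine (bsB_spec m (c i) (r i) (hr i)).trans ?_
        exact Metric.closedBall_subset_ball (hlt i)
      · intro i hi
        rcases o with _ | j
        · exact hsp i
        · have hij : j ≠ i := fun h => hi (by rw [h])
          refine Disjoint.mono_left ?_ (hdis j i hij)
          refine (bsB_spec m (c j) (r j) (hr j)).trans ?_
          exact Metric.closedBall_subset_closedBall (hlt j).le)
    (fun o => Fin (bsSz m n N o)) (bsOn m n N f)
    (by
      rintro (_ | i)
      · exact hf
      · exact bsE_orthonormal m)
  rw [Fintype.sum_option] at key
  have h2 : ∀ i : Fin n, ∑ k : Fin (bsSz m n N (some i)),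
      (‖bsOp T m n c r (some i) (bsOn m n N f (some i) k)‖ ^ 2
        - ‖adjoint (bsOp T m n c r (some i)) (bsOn m n N f (some i) k)‖ ^ 2) =
      m * (θ ^ 2 * ρ i ^ 2) := by
    intro i
    have : ∀ k : Fin m, ‖bsB m (c i) (r i) (bsE.{u} m k)‖ ^ 2
        - ‖adjoint (bsB m (c i) (r i)) (bsE.{u} m k)‖ ^ 2 = θ ^ 2 * ρ i ^ 2 := by
      intro k; rw [bsB_diff_E, hrdef]; ring
    refine (Finset.sum_congr rfl fun k _ => this k).trans ?_
    show ∑ _k : Fin m, θ ^ 2 * ρ i ^ 2 = _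
    simp
  rw [Finset.sum_congr rfl fun i _ => h2 i, ← Finset.mul_sum, ← Finset.mul_sum] at key
  rw [mul_assoc]
  exact key

lemma bs_disc (T : E →L[ℂ] E) (hT : ∀ x, ‖adjoint T x‖ ≤ ‖T x‖) (m : ℕ) (v : Fin m → E)
    (hv : Dense ((Submodule.span ℂ {x | ∃ (j : Fin m) (k : ℕ), x = (T ^ k) (v j)} :
      Submodule ℂ E) : Set E))
    (R : ℝ) (hR : ‖T‖ ≤ R) {n : ℕ} (c : Fin n → ℂ) (ρ : Fin n → ℝ) (hρ : ∀ i, 0 < ρ i)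
    (hdis : ∀ i j, i ≠ j → Disjoint (Metric.closedBall (c i) (ρ i)) (Metric.closedBall (c j) (ρ j)))
    (hsp : ∀ i, Disjoint (spectrum ℂ T) (Metric.closedBall (c i) (ρ i)))
    (hcR : ∀ i, ‖c i‖ + ρ i ≤ R)
    {N : ℕ} (f : Fin N → E) (hf : Orthonormal ℂ f) :
    ∑ k, (‖T (f k)‖ ^ 2 - ‖adjoint T (f k)‖ ^ 2) + m * ∑ i, ρ i ^ 2 ≤ m * R ^ 2 := by
  have ht : Tendsto (fun θ : ℝ => ∑ k, (‖T (f k)‖ ^ 2 - ‖adjoint T (f k)‖ ^ 2) +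
      m * θ ^ 2 * ∑ i, ρ i ^ 2) (𝓝[<] 1) (𝓝 (∑ k, (‖T (f k)‖ ^ 2 - ‖adjoint T (f k)‖ ^ 2) +
      m * 1 ^ 2 * ∑ i, ρ i ^ 2)) := by
    refine Tendsto.mono_left (Continuous.tendsto ?_ 1) nhdsWithin_le_nhds
    fun_prop
  rw [one_pow, mul_one] at ht
  refine le_of_tendsto ht ?_
  have hm : Set.Ioo (0 : ℝ) 1 ∈ 𝓝[<] (1 : ℝ) := Ioo_mem_nhdsLT zero_lt_one
  filter_upwards [hm] with θ hθ
  exact bs_disc_theta T hT m v hv R hR c ρ hρ hdis hsp hcR θ hθ.1 hθ.2 f hf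

end DiscPart
section PackPart

open Filter Topology Polynomial

lemma bs_pack (s : Set ℂ) (hs : IsClosed s) (R : ℝ) : ∃ (t : Set ℂ) (r : ℂ → ℝ),
    (∀ x ∈ t, 0 < r x) ∧ (∀ x ∈ t, Disjoint s (Metric.closedBall x (r x))) ∧
    (∀ x ∈ t, ‖x‖ + r x ≤ R) ∧ (t.PairwiseDisjoint fun x => Metric.closedBall x (r x)) ∧
    ENNReal.ofReal R ^ 2 * NNReal.pi ≤
      (∑' x : t, ENNReal.ofReal (r x) ^ 2) * NNReal.pi + volume s := by
  obtain ⟨t, r, htc, hts, hr, hcov, hdis⟩ :=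
    Besicovitch.exists_disjoint_closedBall_covering_ae (volume : Measure ℂ)
      (fun x => {r | Disjoint s (Metric.closedBall x r) ∧ ‖x‖ + r ≤ R})
      (Metric.ball 0 R \ s)
      (by
        rintro x ⟨hxR, hxs⟩ δ hδ
        have h1 : sᶜ ∈ 𝓝 x := hs.isOpen_compl.mem_nhds hxs
        obtain ⟨ε, hε, hεs⟩ := Metric.nhds_basis_closedBall.mem_iff.1 h1
        have hx : ‖x‖ < R := by simpa using hxR
        have hpos : 0 < min (min ε (δ / 2)) (R - ‖x‖) :=
          lt_min (lt_min hε (by linarith)) (by linarith)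
        refine ⟨min (min ε (δ / 2)) (R - ‖x‖), ⟨?_, ?_⟩, hpos, ?_⟩
        · rw [Set.disjoint_right]
          intro z hz
          exact hεs (Metric.closedBall_subset_closedBall
            ((min_le_left _ _).trans (min_le_left _ _)) hz)
        · have := min_le_right (min ε (δ / 2)) (R - ‖x‖)
          linarith
        · have : min (min ε (δ / 2)) (R - ‖x‖) ≤ δ / 2 :=
            (min_le_left _ _).trans (min_le_right _ _)
          linarith)
      (fun _ => 1) (fun _ _ => zero_lt_one)
  refine ⟨t, r, fun x hx => (hr x hx).2.1, fun x hx => (hr x hx).1.1, fun x hx => (hr x hx).1.2,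
    hdis, ?_⟩
  have h1 : volume (⋃ x ∈ t, Metric.closedBall x (r x)) =
      (∑' x : t, ENNReal.ofReal (r x) ^ 2) * NNReal.pi := by
    rw [measure_biUnion htc hdis fun x _ => Metric.isClosed_closedBall.measurableSet,
      ← ENNReal.tsum_mul_right]
    simp only [Complex.volume_closedBall]
  rw [← Complex.volume_ball 0 R, ← h1]
  have hsub : Metric.ball (0 : ℂ) R ⊆ ((⋃ x ∈ t, Metric.closedBall x (r x)) ∪ s) ∪
      ((Metric.ball 0 R \ s) \ ⋃ x ∈ t, Metric.closedBall x (r x)) := by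
    intro z hz
    by_cases h2 : z ∈ ⋃ x ∈ t, Metric.closedBall x (r x)
    · exact Or.inl (Or.inl h2)
    by_cases h3 : z ∈ s
    · exact Or.inl (Or.inr h3)
    exact Or.inr ⟨⟨hz, h3⟩, h2⟩
  calc volume (Metric.ball (0 : ℂ) R) ≤ _ := measure_mono hsub
    _ ≤ _ := measure_union_le _ _
    _ = volume ((⋃ x ∈ t, Metric.closedBall x (r x)) ∪ s) := by rw [hcov, add_zero]
    _ ≤ _ := measure_union_le _ _

universe u

lemma bs_berger_shaw {E : Type u} [NormedAddCommGroup E] [InnerProductSpace ℂ E] [CompleteSpace E]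
    (T : E →L[ℂ] E) (hT : Hyponormal T) (m : ℕ) (hc : IsPolyCyclicOp T m)
    {N : ℕ} (f : Fin N → E) (hf : Orthonormal ℂ f) :
    ENNReal.ofReal (∑ k, (‖T (f k)‖ ^ 2 - ‖adjoint T (f k)‖ ^ 2)) ≤
      (m : ℝ≥0∞) / ENNReal.ofReal Real.pi * volume (spectrum ℂ T) := by
  have hn : ∀ x, ‖adjoint T x‖ ≤ ‖T x‖ := by
    intro x
    have h1 := hT.inner_nonneg_left x
    rw [bs_cmt_inner] at h1
    have h2 : 0 ≤ ‖T x‖ ^ 2 - ‖adjoint T x‖ ^ 2 := by exact_mod_cast h1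
    exact (pow_le_pow_iff_left₀ (norm_nonneg _) (norm_nonneg _) two_ne_zero).1 (by linarith)
  obtain ⟨ξ, hξm, hξ⟩ := hc.1
  let eq : Fin m ≃ ξ := (Fintype.equivFinOfCardEq (by simpa using hξm)).symm
  have hv : Dense ((Submodule.span ℂ {x | ∃ (j : Fin m) (k : ℕ), x = (T ^ k) ((eq j : E))} :
      Submodule ℂ E) : Set E) := by
    convert hξ using 3
    ext x
    constructor
    · rintro ⟨j, k, rfl⟩
      exact ⟨_, (eq j).2, k, rfl⟩
    · rintro ⟨v, hv, k, rfl⟩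
      exact ⟨eq.symm ⟨v, hv⟩, k, by simp⟩
  set R : ℝ := ‖T‖ with hRdef
  obtain ⟨t, r, hrpos, hrs, hrR, hrd, hvol⟩ :=
    bs_pack (spectrum ℂ T) (spectrum.isClosed T) R
  set S : ℝ := ∑ k, (‖T (f k)‖ ^ 2 - ‖adjoint T (f k)‖ ^ 2) with hS
  have hS0 : 0 ≤ S := Finset.sum_nonneg fun k _ =>
    sub_nonneg.2 (pow_le_pow_left₀ (norm_nonneg _) (hn _) 2)
  have hfin : ∀ F : Finset t, ENNReal.ofReal S + m * ∑ x ∈ F, ENNReal.ofReal (r x) ^ 2 ≤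
      m * ENNReal.ofReal R ^ 2 := by
    intro F
    let e2 : Fin F.card ≃ F := F.equivFin.symm
    have h1 := bs_disc T hn m (fun j => (eq j : E)) hv R le_rfl
      (fun i => ((e2 i : t) : ℂ)) (fun i => r ((e2 i : t) : ℂ))
      (fun i => hrpos _ (e2 i : t).2)
      (fun i j hij => hrd (e2 i : t).2 (e2 j : t).2 (fun h => hij (by
        exact e2.injective (Subtype.ext (Subtype.ext h)))))
      (fun i => hrs _ (e2 i : t).2) (fun i => hrR _ (e2 i : t).2) f hf
    have h2 : ∑ i, r ((e2 i : t) : ℂ) ^ 2 = ∑ x ∈ F, r (x : ℂ) ^ 2 := by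
      rw [← Finset.sum_coe_sort F (fun x : t => r (x : ℂ) ^ 2)]
      exact e2.sum_comp (fun x : F => r ((x : t) : ℂ) ^ 2)
    rw [h2] at h1
    have h3 := ENNReal.ofReal_le_ofReal h1
    rw [ENNReal.ofReal_add hS0 (mul_nonneg (Nat.cast_nonneg _)
        (Finset.sum_nonneg fun _ _ => sq_nonneg _)), ENNReal.ofReal_mul (Nat.cast_nonneg _),
      ENNReal.ofReal_mul (Nat.cast_nonneg _), ENNReal.ofReal_sum_of_nonneg (fun _ _ => sq_nonneg _),
      ENNReal.ofReal_natCast, ENNReal.ofReal_pow (norm_nonneg _)] at h3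
    have h4 : ∑ x ∈ F, ENNReal.ofReal (r x) ^ 2 = ∑ x ∈ F, ENNReal.ofReal (r (x : ℂ) ^ 2) :=
      Finset.sum_congr rfl fun x _ => by rw [ENNReal.ofReal_pow (hrpos _ x.2).le]
    rw [h4]
    exact h3
  have hsup : ENNReal.ofReal S + m * ∑' x : t, ENNReal.ofReal (r x) ^ 2 ≤
      m * ENNReal.ofReal R ^ 2 := by
    rw [ENNReal.tsum_eq_iSup_sum, ENNReal.mul_iSup, ENNReal.add_iSup]
    exact iSup_le hfin
  set X := ∑' x : t, ENNReal.ofReal (r x) ^ 2 with hX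
  have hmX : (m : ℝ≥0∞) * X ≠ ⊤ := by
    refine ne_top_of_le_ne_top (b := (m : ℝ≥0∞) * ENNReal.ofReal R ^ 2) ?_
      (le_trans le_add_self hsup)
    exact ENNReal.mul_ne_top (by simp) (by simp)
  have hpi : ENNReal.ofReal Real.pi = (NNReal.pi : ℝ≥0∞) := by
    rw [← NNReal.coe_real_pi, ENNReal.ofReal_coe_nnreal]
  have hpi0 : (NNReal.pi : ℝ≥0∞) ≠ 0 := by
    exact_mod_cast NNReal.pi_ne_zero
  have h5 : (m : ℝ≥0∞) * ENNReal.ofReal R ^ 2 ≤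
      (m : ℝ≥0∞) / ENNReal.ofReal Real.pi * volume (spectrum ℂ T) + m * X := by
    rw [hpi]
    calc (m : ℝ≥0∞) * ENNReal.ofReal R ^ 2
        = m / NNReal.pi * (ENNReal.ofReal R ^ 2 * NNReal.pi) := by
          rw [mul_comm _ (NNReal.pi : ℝ≥0∞), ← mul_assoc,
            ENNReal.div_mul_cancel hpi0 ENNReal.coe_ne_top]
      _ ≤ m / NNReal.pi * (X * NNReal.pi + volume (spectrum ℂ T)) := by gcongr
      _ = _ := by
          rw [mul_add, mul_comm X, ← mul_assoc, ENNReal.div_mul_cancel hpi0 ENNReal.coe_ne_top,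
            add_comm]
  exact (ENNReal.add_le_add_iff_right hmX).1 (hsup.trans h5)

end PackPart
section TensorPart

open Filter Topology

lemma bs_hs_fin {ι : Type*} (A : H →L[ℂ] H) (e : ι → H) (he : Orthonormal ℂ e) (F : Finset ι) :
    (∑ a ∈ F, ‖A (e a)‖ₑ ^ (2 : ℝ)) ^ (1 / 2 : ℝ) ≤ hsNorm A := by
  rw [hsNorm]
  refine ENNReal.rpow_le_rpow ?_ (by norm_num)
  let e2 : Fin F.card ≃ F := F.equivFin.symm
  have ho : Orthonormal ℂ (fun i => e (e2 i)) :=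
    he.comp _ (Subtype.val_injective.comp e2.injective)
  have h1 : ∑ a ∈ F, ‖A (e a)‖ₑ ^ (2 : ℝ) = ∑ i, (‖A (e (e2 i))‖₊ : ℝ≥0∞) ^ 2 := by
    rw [← Finset.sum_coe_sort F]
    rw [← e2.sum_comp]
    refine Finset.sum_congr rfl fun i _ => ?_
    rw [ENNReal.rpow_ofNat]; rfl
  rw [h1]
  exact le_iSup_of_le F.card (le_iSup_of_le (fun i => e (e2 i)) (le_iSup_of_le ho le_rfl))

lemma bs_hs_tsum {ι : Type*} (A B : H →L[ℂ] H) (e : ι → H) (he : Orthonormal ℂ e) :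
    ∑' a, ‖A (e a)‖ₑ * ‖B (e a)‖ₑ ≤ hsNorm A * hsNorm B := by
  refine ENNReal.summable.tsum_le_of_sum_le fun F => ?_
  refine (ENNReal.inner_le_Lp_mul_Lq F _ _ Real.HolderConjugate.two_two).trans ?_
  exact mul_le_mul' (bs_hs_fin A e he F) (bs_hs_fin B e he F)

lemma bs_sum_S {ι : Type*} {T S : H →L[ℂ] H} (h1 : adjoint S = S)
    (h2 : S * S = cmt (adjoint T) T) (hT : Hyponormal T) (m : ℕ) (hc : IsPolyCyclicOp T m)
    (e : ι → H) (he : Orthonormal ℂ e) :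
    ∑' b, ‖S (e b)‖ₑ * ‖S (e b)‖ₑ ≤
      (m : ℝ≥0∞) / ENNReal.ofReal Real.pi * volume (spectrum ℂ T) := by
  refine ENNReal.summable.tsum_le_of_sum_le fun F => ?_
  let e2 : Fin F.card ≃ F := F.equivFin.symm
  have ho : Orthonormal ℂ (fun i => e (e2 i)) :=
    he.comp _ (Subtype.val_injective.comp e2.injective)
  refine le_trans (le_of_eq ?_) (bs_berger_shaw T hT m hc _ ho)
  have h3 : ∀ x, ‖T x‖ ^ 2 - ‖adjoint T x‖ ^ 2 = ‖S x‖ ^ 2 := by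
    intro x
    have h4 := bs_sqrt_norm h1 h2 x
    rw [bs_cmt_inner] at h4
    exact_mod_cast h4
  simp only [h3]
  rw [ENNReal.ofReal_sum_of_nonneg (fun _ _ => sq_nonneg _), ← Finset.sum_coe_sort F,
    ← e2.sum_comp]
  refine Finset.sum_congr rfl fun i _ => ?_
  rw [ENNReal.ofReal_pow (norm_nonneg _), ofReal_norm, sq]

lemma bs_traceNorm_le {I : Type*} (p q : I → H) (C : H →L[ℂ] H)
    (h : HasSum (fun i => InnerProductSpace.rankOne ℂ (p i) (q i)) C) :
    traceNorm C ≤ ∑' i, ‖p i‖ₑ * ‖q i‖ₑ := by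
  rw [traceNorm]
  refine iSup_le fun n => iSup_le fun f => iSup_le fun g => iSup_le fun hf => iSup_le fun hg => ?_
  have hb : ∀ (f : Fin n → H), Orthonormal ℂ f → ∀ x : H,
      (∑ k, ‖@inner ℂ _ _ x (f k)‖ₑ ^ (2 : ℝ)) ^ (1 / 2 : ℝ) ≤ ‖x‖ₑ := by
    intro f hf x
    have h1 := hf.sum_inner_products_le x (s := Finset.univ)
    have h2 : ∑ k, ‖@inner ℂ _ _ x (f k)‖ₑ ^ (2 : ℝ) ≤ ‖x‖ₑ ^ (2 : ℝ) := by
      have h3 := ENNReal.ofReal_le_ofReal h1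
      rw [ENNReal.ofReal_sum_of_nonneg (fun _ _ => sq_nonneg _),
        ENNReal.ofReal_pow (norm_nonneg _), ofReal_norm] at h3
      rw [ENNReal.rpow_ofNat]
      refine le_trans (le_of_eq (Finset.sum_congr rfl fun k _ => ?_)) h3
      rw [ENNReal.rpow_ofNat, ENNReal.ofReal_pow (norm_nonneg _), norm_inner_symm, ofReal_norm]
    calc _ ≤ (‖x‖ₑ ^ (2 : ℝ)) ^ (1 / 2 : ℝ) := ENNReal.rpow_le_rpow h2 (by norm_num)
      _ = ‖x‖ₑ := by rw [← ENNReal.rpow_mul]; norm_num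
  have hk : ∀ k, (‖@inner ℂ _ _ (C (f k)) (g k)‖₊ : ℝ≥0∞) ≤
      ∑' i, ‖@inner ℂ _ _ (p i) (g k)‖ₑ * ‖@inner ℂ _ _ (q i) (f k)‖ₑ := by
    intro k
    have h1 := h.mapL (ContinuousLinearMap.apply ℂ H (f k))
    have h2 := h1.mapL (innerSL ℂ (g k))
    simp only [apply_apply, InnerProductSpace.rankOne_apply, innerSL_apply_apply,
      inner_smul_right] at h2
    have h3 : (‖@inner ℂ _ _ (C (f k)) (g k)‖₊ : ℝ≥0∞) = ‖@inner ℂ _ _ (g k) (C (f k))‖ₑ := by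
      show ‖@inner ℂ _ _ (C (f k)) (g k)‖ₑ = _
      rw [← ofReal_norm, norm_inner_symm, ofReal_norm]
    rw [h3, ← h2.tsum_eq]
    refine enorm_tsum_le_tsum_enorm.trans (le_of_eq (tsum_congr fun i => ?_))
    rw [enorm_mul, mul_comm]
    congr 1
    rw [← ofReal_norm, norm_inner_symm, ofReal_norm]
  refine (Finset.sum_le_sum fun k _ => hk k).trans ?_
  rw [← Summable.tsum_finsetSum fun _ _ => ENNReal.summable]
  refine ENNReal.tsum_le_tsum fun i => ?_
  refine (ENNReal.inner_le_Lp_mul_Lq Finset.univ _ _ Real.HolderConjugate.two_two).trans ?_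
  exact mul_le_mul' (hb g hg (p i)) (hb f hf (q i))

variable {tmul : H₁ →ₗ[ℂ] H₂ →ₗ[ℂ] H}

lemma bs_tmul_norm (ht : IsHilbertTensor tmul) (x : H₁) (y : H₂) :
    ‖tmul x y‖ = ‖x‖ * ‖y‖ := by
  have h := ht.inner_tmul x y x y
  rw [inner_self_eq_norm_sq_to_K, inner_self_eq_norm_sq_to_K, inner_self_eq_norm_sq_to_K] at h
  have h2 : ‖tmul x y‖ ^ 2 = ‖x‖ ^ 2 * ‖y‖ ^ 2 := by exact_mod_cast h
  rw [← mul_pow] at h2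
  exact (pow_left_inj₀ (norm_nonneg _) (by positivity) two_ne_zero).1 h2

lemma bs_tmul_ext (ht : IsHilbertTensor tmul) {B C : H →L[ℂ] H}
    (h : ∀ x y, B (tmul x y) = C (tmul x y)) : B = C := by
  refine ContinuousLinearMap.ext_on ht.dense_span ?_
  rintro _ ⟨x, y, rfl⟩
  exact h x y

lemma bs_tmul_vec (ht : IsHilbertTensor tmul) {u v : H}
    (h : ∀ x y, @inner ℂ _ _ (tmul x y) u = @inner ℂ _ _ (tmul x y) v) : u = v := by
  have h2 : ∀ w : H, @inner ℂ _ _ u w = @inner ℂ _ _ v w := by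
    have : innerSL ℂ u = innerSL ℂ v := by
      refine ContinuousLinearMap.ext_on ht.dense_span ?_
      rintro _ ⟨x, y, rfl⟩
      simp only [innerSL_apply_apply]
      rw [← inner_conj_symm, h, inner_conj_symm]
    intro w
    have h3 := congrArg (fun φ : H →L[ℂ] ℂ => φ w) this
    simpa using h3
  exact ext_inner_right ℂ h2

lemma bs_tensor_adj (ht : IsHilbertTensor tmul) {A : H₁ →L[ℂ] H₁} {T : H₂ →L[ℂ] H₂}
    {AT : H →L[ℂ] H} (h : IsTensorOp tmul A T AT) :
    IsTensorOp tmul (adjoint A) (adjoint T) (adjoint AT) := by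
  intro x y
  refine bs_tmul_vec ht fun u v => ?_
  rw [adjoint_inner_right, h, ht.inner_tmul, ht.inner_tmul, adjoint_inner_right,
    adjoint_inner_right]

lemma bs_tensor_cmt (ht : IsHilbertTensor tmul) {A B : H₁ →L[ℂ] H₁} {T : H₂ →L[ℂ] H₂}
    {AT BT : H →L[ℂ] H} (hA : IsTensorOp tmul A T AT) (hB : IsTensorOp tmul B T BT)
    (hc : Commute A (adjoint B)) :
    IsTensorOp tmul (A * adjoint B) (cmt (adjoint T) T) (cmt (adjoint BT) AT) := by
  intro x y
  have hB' := bs_tensor_adj ht hB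
  have h1 : adjoint B (A x) = A (adjoint B x) := by
    have := congrArg (fun φ : H₁ →L[ℂ] H₁ => φ x) hc.eq
    exact this.symm
  simp only [cmt, sub_apply, mul_apply_eq_comp]
  rw [hA, hB', hB', hA, h1, map_sub]

lemma bs_tensor_expand (ht : IsHilbertTensor tmul) {A B : H₁ →L[ℂ] H₁} {T S : H₂ →L[ℂ] H₂}
    {AT BT : H →L[ℂ] H} (hA : IsTensorOp tmul A T AT) (hB : IsTensorOp tmul B T BT)
    (hc : Commute A (adjoint B)) (h1 : adjoint S = S) (h2 : S * S = cmt (adjoint T) T)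
    {I J : Type*} (e : HilbertBasis I ℂ H₁) (f : HilbertBasis J ℂ H₂)
    (hfin : ∑' q : I × J, ‖tmul (A (e q.1)) (S (f q.2))‖ₑ * ‖tmul (B (e q.1)) (S (f q.2))‖ₑ ≠ ⊤) :
    HasSum (fun q : I × J => InnerProductSpace.rankOne ℂ (tmul (A (e q.1)) (S (f q.2)))
      (tmul (B (e q.1)) (S (f q.2)))) (cmt (adjoint BT) AT) := by
  have hsum : Summable (fun q : I × J => InnerProductSpace.rankOne ℂ
      (tmul (A (e q.1)) (S (f q.2))) (tmul (B (e q.1)) (S (f q.2)))) := by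
    refine Summable.of_norm ?_
    rw [← tsum_enorm_ne_top_iff_summable_norm]
    refine ne_of_eq_of_ne (tsum_congr fun q => ?_) hfin
    rw [← ofReal_norm, InnerProductSpace.norm_rankOne, ENNReal.ofReal_mul (norm_nonneg _),
      ofReal_norm, ofReal_norm]
  obtain ⟨K', hK⟩ := hsum
  suffices hKC : K' = cmt (adjoint BT) AT by rwa [hKC] at hK
  refine bs_tmul_ext ht fun x y => ?_
  rw [bs_tensor_cmt ht hA hB hc x y]
  let L1 : H₁ → H₂ →L[ℂ] H := fun x => (tmul x).mkContinuous ‖x‖ fun y => (bs_tmul_norm ht x y).le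
  let L2 : H₂ → H₁ →L[ℂ] H := fun y => (tmul.flip y).mkContinuous ‖y‖ fun x => by
    rw [mul_comm]; exact (bs_tmul_norm ht x y).le
  have hD : HasSum (fun b => @inner ℂ _ _ (S (f b)) y • S (f b)) (cmt (adjoint T) T y) := by
    have := (f.hasSum_repr (S y)).mapL S
    rw [← h2, mul_apply_eq_comp]
    convert this using 2 with b
    rw [map_smul, HilbertBasis.repr_apply_apply]
    congr 1
    nth_rewrite 2 [← h1]
    rw [adjoint_inner_right]
  have hAB : HasSum (fun a => @inner ℂ _ _ (B (e a)) x • A (e a)) ((A * adjoint B) x) := by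
    have := (e.hasSum_repr (adjoint B x)).mapL A
    rw [mul_apply_eq_comp]
    convert this using 2 with a
    rw [map_smul, HilbertBasis.repr_apply_apply, adjoint_inner_right]
  have hK2 := hK.mapL (ContinuousLinearMap.apply ℂ H (tmul x y))
  have hfib : ∀ a, HasSum (fun b => ContinuousLinearMap.apply ℂ H (tmul x y)
      (InnerProductSpace.rankOne ℂ (tmul (A (e a)) (S (f b))) (tmul (B (e a)) (S (f b)))))
      (tmul (@inner ℂ _ _ (B (e a)) x • A (e a)) (cmt (adjoint T) T y)) := by
    intro a
    have h3 := hD.mapL (L1 (@inner ℂ _ _ (B (e a)) x • A (e a)))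
    have h4 : ∀ b, InnerProductSpace.rankOne ℂ (tmul (A (e a)) (S (f b)))
        (tmul (B (e a)) (S (f b))) (tmul x y) =
        tmul (@inner ℂ _ _ (B (e a)) x • A (e a)) (@inner ℂ _ _ (S (f b)) y • S (f b)) := by
      intro b
      rw [InnerProductSpace.rankOne_apply, ht.inner_tmul, map_smul, map_smul, LinearMap.smul_apply,
        smul_smul, mul_comm]
    have h5 : (fun b => ContinuousLinearMap.apply ℂ H (tmul x y)
      (InnerProductSpace.rankOne ℂ (tmul (A (e a)) (S (f b))) (tmul (B (e a)) (S (f b))))) =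
      fun b => L1 (@inner ℂ _ _ (B (e a)) x • A (e a)) (@inner ℂ _ _ (S (f b)) y • S (f b)) :=
      funext h4
    rw [h5]
    exact h3
  have hout := hAB.mapL (L2 (cmt (adjoint T) T y))
  exact (hK2.prod_fiberwise hfib).unique hout

end TensorPart
/-- a tuple of commuting normal Hilbert-Schmidt operators tensored with a
hyponormal `m`-polynomially cyclic operator is commuting, jointly hyponormal, and all mixed
commutators are trace class with the Berger-Shaw type bound. -/
theorem statement_1 {d : ℕ} [TopologicalSpace.SeparableSpace H₂]
    (A : Fin d → H₁ →L[ℂ] H₁) (T : H₂ →L[ℂ] H₂)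
    (hAcomm : ∀ i j, Commute (A i) (A j)) (hAnormal : ∀ i, IsStarNormal (A i))
    (hAHS : ∀ i, hsNorm (A i) ≠ ⊤)
    (hT : Hyponormal T) (m : ℕ) (hTcyc : IsPolyCyclicOp T m)
    (tmul : H₁ →ₗ[ℂ] H₂ →ₗ[ℂ] H) (htmul : IsHilbertTensor tmul)
    (AT : Fin d → H →L[ℂ] H) (hAT : ∀ i, IsTensorOp tmul (A i) T (AT i)) :
    (∀ i j, Commute (AT i) (AT j)) ∧ JointlyHyponormal AT ∧
      ∀ i j, IsTraceClass (cmt (adjoint (AT j)) (AT i)) ∧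
        traceNorm (cmt (adjoint (AT j)) (AT i)) ≤
          (m : ℝ≥0∞) / ENNReal.ofReal Real.pi * volume (spectrum ℂ T) *
            hsNorm (A i) * hsNorm (A j) := by
  classical
  have hcomm : ∀ i j, Commute (A i) (adjoint (A j)) := fun i j =>
    (hAnormal j).commute_star_right (hAcomm i j)
  obtain ⟨S, hS1, hS2⟩ := bs_sqrt _ hT
  obtain ⟨w1, e, -⟩ := exists_hilbertBasis ℂ H₁
  obtain ⟨w2, f, -⟩ := exists_hilbertBasis ℂ H₂
  set bd : ℝ≥0∞ := (m : ℝ≥0∞) / ENNReal.ofReal Real.pi * volume (spectrum ℂ T) with hbd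
  have hbdfin : bd ≠ ⊤ := by
    refine ENNReal.mul_ne_top (ENNReal.div_ne_top (by simp) ?_) ?_
    · simpa using Real.pi_pos
    · exact (spectrum.isCompact T).measure_lt_top.ne
  have hbound : ∀ i j, ∑' q : w1 × w2, ‖tmul (A i (e q.1)) (S (f q.2))‖ₑ *
      ‖tmul (A j (e q.1)) (S (f q.2))‖ₑ ≤ bd * hsNorm (A i) * hsNorm (A j) := by
    intro i j
    have h1 : ∀ q : w1 × w2, ‖tmul (A i (e q.1)) (S (f q.2))‖ₑ *
        ‖tmul (A j (e q.1)) (S (f q.2))‖ₑ =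
        (‖A i (e q.1)‖ₑ * ‖A j (e q.1)‖ₑ) * (‖S (f q.2)‖ₑ * ‖S (f q.2)‖ₑ) := by
      intro q
      have h2 : ∀ x y, ‖tmul x y‖ₑ = ‖x‖ₑ * ‖y‖ₑ := by
        intro x y
        rw [← ofReal_norm, bs_tmul_norm htmul, ENNReal.ofReal_mul (norm_nonneg _), ofReal_norm,
          ofReal_norm]
      rw [h2, h2]; ring
    rw [tsum_congr h1, ENNReal.tsum_prod (f := fun a b =>
      (‖A i (e a)‖ₑ * ‖A j (e a)‖ₑ) * (‖S (f b)‖ₑ * ‖S (f b)‖ₑ))]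
    simp only [ENNReal.tsum_mul_left, ENNReal.tsum_mul_right]
    calc _ ≤ (hsNorm (A i) * hsNorm (A j)) * bd :=
          mul_le_mul' (bs_hs_tsum _ _ e e.orthonormal)
            (bs_sum_S hS1 hS2 hT m hTcyc f f.orthonormal)
      _ = _ := by ring
  have hfin : ∀ i j, bd * hsNorm (A i) * hsNorm (A j) ≠ ⊤ := fun i j =>
    ENNReal.mul_ne_top (ENNReal.mul_ne_top hbdfin (hAHS i)) (hAHS j)
  have hexp : ∀ i j, HasSum (fun q : w1 × w2 =>
      InnerProductSpace.rankOne ℂ (tmul (A i (e q.1)) (S (f q.2)))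
        (tmul (A j (e q.1)) (S (f q.2)))) (cmt (adjoint (AT j)) (AT i)) := fun i j =>
    bs_tensor_expand htmul (hAT i) (hAT j) (hcomm i j) hS1 hS2 e f
      (ne_top_of_le_ne_top (hfin i j) (hbound i j))
  have htr : ∀ i j, traceNorm (cmt (adjoint (AT j)) (AT i)) ≤ bd * hsNorm (A i) * hsNorm (A j) :=
    fun i j => (bs_traceNorm_le _ _ _ (hexp i j)).trans (hbound i j)
  refine ⟨fun i j => ?_, ?_, fun i j => ⟨ne_top_of_le_ne_top (hfin i j) (htr i j), htr i j⟩⟩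
  · refine bs_tmul_ext htmul fun x y => ?_
    rw [mul_apply_eq_comp, mul_apply_eq_comp, hAT j, hAT i, hAT i, hAT j]
    have h1 : A i (A j x) = A j (A i x) :=
      congrArg (fun φ : H₁ →L[ℂ] H₁ => φ x) (hAcomm i j).eq
    rw [h1]
  · intro x
    have h1 : ∀ i j, HasSum (fun q : w1 × w2 =>
        @inner ℂ _ _ (x i) (tmul (A i (e q.1)) (S (f q.2))) *
          @inner ℂ _ _ (tmul (A j (e q.1)) (S (f q.2))) (x j))
        (@inner ℂ _ _ (x i) (cmt (adjoint (AT j)) (AT i) (x j))) := by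
      intro i j
      have h2 := ((hexp i j).mapL (ContinuousLinearMap.apply ℂ H (x j))).mapL (innerSL ℂ (x i))
      simp only [apply_apply, InnerProductSpace.rankOne_apply, innerSL_apply_apply,
        inner_smul_right] at h2
      simp only [mul_comm (@inner ℂ _ _ (x i) _)]
      exact h2
    have h3 := hasSum_sum (s := Finset.univ) fun i _ =>
      hasSum_sum (s := Finset.univ) fun j _ => h1 i j
    refine h3.nonneg fun q => ?_
    rw [← Finset.sum_mul_sum]
    have h4 : ∑ j, @inner ℂ _ _ (tmul (A j (e q.1)) (S (f q.2))) (x j) =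
        star (∑ i, @inner ℂ _ _ (x i) (tmul (A i (e q.1)) (S (f q.2)))) := by
      rw [star_sum]
      exact Finset.sum_congr rfl fun j _ => (inner_conj_symm _ _).symm
    rw [h4]
    exact mul_star_self_nonneg _
end
end

section
/- Let X and Z be non-negative definite bounded operators on a complex Hilbert space H₁ and let Y be a nonzero bounded operator on a complex Hilbert space H₂. If either X ⊗ Y*Y ≥ Z ⊗ YY* or Y*Y ⊗ X ≥ YY* ⊗ Z (as operators on the Hilbert space tensor product), then X ≥ Z. -/
open ContinuousLinearMap MeasureTheory
open scoped ENNReal NNReal ComplexOrder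

noncomputable section

variable {H H₁ H₂ K : Type*}
variable [NormedAddCommGroup H] [InnerProductSpace ℂ H] [CompleteSpace H]
variable [NormedAddCommGroup H₁] [InnerProductSpace ℂ H₁] [CompleteSpace H₁]
variable [NormedAddCommGroup H₂] [InnerProductSpace ℂ H₂] [CompleteSpace H₂]
variable [NormedAddCommGroup K] [InnerProductSpace ℂ K] [CompleteSpace K]

theorem aux_sup {E : Type*} [NormedAddCommGroup E] [InnerProductSpace ℂ E] [CompleteSpace E]
    (Y : E →L[ℂ] E) (hY : Y ≠ 0) (a b : ℝ) (ha : 0 ≤ a) (hb : 0 ≤ b)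
    (h : ∀ y, b * ‖adjoint Y y‖ ^ 2 ≤ a * ‖Y y‖ ^ 2) : b ≤ a := by
  by_contra hab
  push Not at hab
  have hb0 : 0 < b := lt_of_le_of_lt ha hab
  have hYn : 0 < ‖Y‖ := norm_pos_iff.mpr hY
  have h1 : ‖adjoint Y‖ ≤ Real.sqrt (a / b) * ‖Y‖ := by
    refine ContinuousLinearMap.opNorm_le_bound _ (by positivity) fun y => ?_
    refine (sq_le_sq₀ (norm_nonneg _) (by positivity)).mp ?_
    rw [mul_assoc, mul_pow, Real.sq_sqrt (by positivity), div_mul_eq_mul_div, le_div_iff₀ hb0]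
    have h2 : ‖Y y‖ ^ 2 ≤ (‖Y‖ * ‖y‖) ^ 2 := by gcongr; exact Y.le_opNorm y
    have h3 := mul_le_mul_of_nonneg_left h2 ha
    linarith [h y]
  rw [LinearIsometryEquiv.norm_map] at h1
  have h4 : Real.sqrt (a / b) < 1 := by
    rw [Real.sqrt_lt' one_pos, one_pow, div_lt_one hb0]; exact hab
  nlinarith

theorem aux_form {E : Type*} [NormedAddCommGroup E] [InnerProductSpace ℂ E] [CompleteSpace E]
    {A : E →L[ℂ] E} (hA : A.IsPositive) (x : E) :
    0 ≤ A.reApplyInnerSelf x ∧ (@inner ℂ _ _ (A x) x) = ((A.reApplyInnerSelf x : ℝ) : ℂ) := by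
  have h1 := hA.inner_nonneg_left x
  rw [Complex.nonneg_iff] at h1
  refine ⟨h1.1, Complex.ext rfl ?_⟩
  rw [← h1.2]; simp

theorem aux_main {E F G : Type*} [NormedAddCommGroup E] [InnerProductSpace ℂ E] [CompleteSpace E]
    [NormedAddCommGroup F] [InnerProductSpace ℂ F] [CompleteSpace F]
    [NormedAddCommGroup G] [InnerProductSpace ℂ G] [CompleteSpace G]
    (X Z : E →L[ℂ] E) (Y : F →L[ℂ] F)
    (hX : X.IsPositive) (hZ : Z.IsPositive) (hY : Y ≠ 0)
    (t : E → F → G)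
    (ht : ∀ x₁ x₂ y₁ y₂, @inner ℂ _ _ (t x₁ x₂) (t y₁ y₂) =
      @inner ℂ _ _ x₁ y₁ * @inner ℂ _ _ x₂ y₂) (P Q : G →L[ℂ] G)
    (hP : ∀ x y, P (t x y) = t (X x) ((adjoint Y * Y) y))
    (hQ : ∀ x y, Q (t x y) = t (Z x) ((Y * adjoint Y) y))
    (hPQ : (P - Q).IsPositive) : (X - Z).IsPositive := by
  rw [ContinuousLinearMap.isPositive_def]
  refine ⟨hX.isSelfAdjoint.isSymmetric.sub hZ.isSelfAdjoint.isSymmetric, fun x => ?_⟩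
  have key : Z.reApplyInnerSelf x ≤ X.reApplyInnerSelf x := by
    refine aux_sup Y hY _ _ (aux_form hX x).1 (aux_form hZ x).1 fun y => ?_
    have h1 := hPQ.inner_nonneg_left (t x y)
    rw [ContinuousLinearMap.sub_apply, inner_sub_left, hP, hQ, ht, ht, (aux_form hX x).2,
      (aux_form hZ x).2, ContinuousLinearMap.mul_apply, ContinuousLinearMap.mul_apply,
      ContinuousLinearMap.adjoint_inner_left, ← ContinuousLinearMap.adjoint_inner_right Y (adjoint Y y) y,
      inner_self_eq_norm_sq_to_K, inner_self_eq_norm_sq_to_K] at h1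
    have h2 : (0 : ℂ) ≤ ((X.reApplyInnerSelf x * ‖Y y‖ ^ 2
        - Z.reApplyInnerSelf x * ‖adjoint Y y‖ ^ 2 : ℝ) : ℂ) := by
      push_cast; exact h1
    have h3 := Complex.zero_le_real.mp h2
    linarith
  rw [ContinuousLinearMap.reApplyInnerSelf_apply, ContinuousLinearMap.sub_apply, inner_sub_left,
    map_sub]
  exact sub_nonneg.mpr key

/-- if `X ⊗ Y*Y ≥ Z ⊗ YY*` or `Y*Y ⊗ X ≥ YY* ⊗ Z` with `X, Z ≥ 0` and `Y ≠ 0`,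
then `X ≥ Z`. -/
theorem statement_2 (X Z : H₁ →L[ℂ] H₁) (Y : H₂ →L[ℂ] H₂)
    (hX : X.IsPositive) (hZ : Z.IsPositive) (hY : Y ≠ 0)
    (tmul : H₁ →ₗ[ℂ] H₂ →ₗ[ℂ] H) (htmul : IsHilbertTensor tmul)
    (tmul' : H₂ →ₗ[ℂ] H₁ →ₗ[ℂ] K) (htmul' : IsHilbertTensor tmul')
    (h : (∃ P Q : H →L[ℂ] H, IsTensorOp tmul X (adjoint Y * Y) P ∧
            IsTensorOp tmul Z (Y * adjoint Y) Q ∧ (P - Q).IsPositive) ∨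
         (∃ P Q : K →L[ℂ] K, IsTensorOp tmul' (adjoint Y * Y) X P ∧
            IsTensorOp tmul' (Y * adjoint Y) Z Q ∧ (P - Q).IsPositive)) :
    (X - Z).IsPositive := by
  rcases h with ⟨P, Q, hP, hQ, hPQ⟩ | ⟨P, Q, hP, hQ, hPQ⟩
  · exact aux_main X Z Y hX hZ hY (fun x y => tmul x y) htmul.inner_tmul P Q hP hQ hPQ
  · exact aux_main X Z Y hX hZ hY (fun x y => tmul' y x)
      (fun x₁ x₂ y₁ y₂ => by rw [htmul'.inner_tmul, mul_comm]) P Q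
      (fun x y => hP y x) (fun x y => hQ y x) hPQ
end
end

section
/- Let T = (T_1, …, T_d) be a commuting projectively hyponormal d-tuple of bounded operators on a complex separable Hilbert space H. Assume that for each 1 ≤ k ≤ d the self-commutator [T_k*, T_k] is trace class. Then [T_j*, T_k] is trace class for all 1 ≤ j, k ≤ d, and moreover ‖[T_j*, T_k]‖₁ ≤ ‖[T_k*, T_k]‖₁ + ‖[T_j*, T_j]‖₁. -/
open ContinuousLinearMap MeasureTheory
open scoped ENNReal NNReal ComplexOrder

noncomputable section

variable {H H₁ H₂ K : Type*}
variable [NormedAddCommGroup H] [InnerProductSpace ℂ H] [CompleteSpace H]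
variable [NormedAddCommGroup H₁] [InnerProductSpace ℂ H₁] [CompleteSpace H₁]
variable [NormedAddCommGroup H₂] [InnerProductSpace ℂ H₂] [CompleteSpace H₂]
variable [NormedAddCommGroup K] [InnerProductSpace ℂ K] [CompleteSpace K]

/-- The quadratic form of a commutator `[A*, B]`. -/
lemma aux_inner_cmt (A B : H →L[ℂ] H) (x : H) :
    @inner ℂ _ _ x (cmt (adjoint A) B x) =
      @inner ℂ _ _ (A x) (B x) - @inner ℂ _ _ (adjoint B x) (adjoint A x) := by
  simp only [cmt, ContinuousLinearMap.sub_apply, ContinuousLinearMap.mul_apply, inner_sub_right]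
  rw [ContinuousLinearMap.adjoint_inner_right, ContinuousLinearMap.adjoint_inner_left B]

lemma aux_hypo (L : H →L[ℂ] H) (h : Hyponormal L) (x : H) :
    ‖adjoint L x‖ ^ 2 ≤ ‖L x‖ ^ 2 := by
  have h1 := h.re_inner_nonneg_right x
  rw [aux_inner_cmt, map_sub, inner_self_eq_norm_sq, inner_self_eq_norm_sq] at h1
  linarith

lemma aux_q (A : H →L[ℂ] H) (x : H) :
    RCLike.re (@inner ℂ _ _ (cmt (adjoint A) A x) x) = ‖A x‖ ^ 2 - ‖adjoint A x‖ ^ 2 := by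
  rw [inner_re_symm, aux_inner_cmt, map_sub, inner_self_eq_norm_sq, inner_self_eq_norm_sq]

lemma aux_unit (A B : H →L[ℂ] H) (b : ℂ) (hb : ‖b‖ = 1) (h : Hyponormal (A + b • B)) (x : H) :
    0 ≤ (‖A x‖ ^ 2 - ‖adjoint A x‖ ^ 2) + (‖B x‖ ^ 2 - ‖adjoint B x‖ ^ 2) +
      2 * RCLike.re (b * @inner ℂ _ _ x (cmt (adjoint A) B x)) := by
  have h1 := aux_hypo _ h x
  have e : adjoint (A + b • B) = adjoint A + (starRingEnd ℂ b) • adjoint B := by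
    rw [map_add, map_smulₛₗ]
  rw [e] at h1
  simp only [ContinuousLinearMap.add_apply, ContinuousLinearMap.smul_apply] at h1
  rw [@norm_add_sq ℂ, @norm_add_sq ℂ, norm_smul, norm_smul, inner_smul_right,
    inner_smul_right, RCLike.norm_conj, hb] at h1
  have h2 : RCLike.re ((starRingEnd ℂ) b * @inner ℂ _ _ (adjoint A x) (adjoint B x)) =
      RCLike.re (b * @inner ℂ _ _ (adjoint B x) (adjoint A x)) := by
    rw [← RCLike.conj_re, map_mul, RCLike.conj_conj, inner_conj_symm]
  rw [h2] at h1
  rw [aux_inner_cmt, mul_sub, map_sub]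
  linarith

lemma aux_diag (A B : H →L[ℂ] H) (h : ∀ b : ℂ, Hyponormal (A + b • B)) (x : H) :
    2 * ‖@inner ℂ _ _ (cmt (adjoint A) B x) x‖ ≤
      (‖A x‖ ^ 2 - ‖adjoint A x‖ ^ 2) + (‖B x‖ ^ 2 - ‖adjoint B x‖ ^ 2) := by
  rw [norm_inner_symm]
  set z := @inner ℂ _ _ x (cmt (adjoint A) B x) with hz
  obtain ⟨c, hc, hcz⟩ := RCLike.exists_norm_mul_eq_self z
  have hcc : (starRingEnd ℂ c) * c = 1 := by
    rw [RCLike.conj_mul, hc]; simp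
  have h1 := aux_unit A B (-(starRingEnd ℂ c)) (by rw [norm_neg, RCLike.norm_conj, hc]) (h _) x
  rw [← hz] at h1
  have h2 : -(starRingEnd ℂ c) * z = -((‖z‖ : ℝ) : ℂ) := by
    conv_lhs => rw [← hcz]
    linear_combination (-((‖z‖ : ℝ) : ℂ)) * hcc
  rw [h2] at h1
  have h3 : RCLike.re (-((‖z‖ : ℝ) : ℂ)) = -‖z‖ := by simp
  rw [h3] at h1
  linarith

lemma aux_par (A : H →L[ℂ] H) (x y : H) :
    ‖A (x + y)‖ ^ 2 + ‖A (x - y)‖ ^ 2 = 2 * (‖A x‖ ^ 2 + ‖A y‖ ^ 2) := by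
  rw [map_add, map_sub]
  have := parallelogram_law_with_norm ℂ (A x) (A y)
  nlinarith

lemma aux_off (A B : H →L[ℂ] H) (h : ∀ b : ℂ, Hyponormal (A + b • B)) (y x : H) :
    2 * ‖@inner ℂ _ _ (cmt (adjoint A) B y) x‖ ≤
      ((‖A x‖ ^ 2 - ‖adjoint A x‖ ^ 2) + (‖B x‖ ^ 2 - ‖adjoint B x‖ ^ 2)) +
      ((‖A y‖ ^ 2 - ‖adjoint A y‖ ^ 2) + (‖B y‖ ^ 2 - ‖adjoint B y‖ ^ 2)) := by
  have hp := inner_map_polarization ((cmt (adjoint A) B : H →L[ℂ] H) : H →ₗ[ℂ] H) x y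
  simp only [ContinuousLinearMap.coe_coe] at hp
  have d1 := aux_diag A B h (x + y)
  have d2 := aux_diag A B h (x - y)
  have d3 := aux_diag A B h (x + Complex.I • y)
  have d4 := aux_diag A B h (x - Complex.I • y)
  have hI : ∀ D : H →L[ℂ] H, ‖D (Complex.I • y)‖ = ‖D y‖ := by
    intro D; rw [map_smul, norm_smul, Complex.norm_I, one_mul]
  have p1 := fun D : H →L[ℂ] H => aux_par D x y
  have p2 : ∀ D : H →L[ℂ] H, ‖D (x + Complex.I • y)‖ ^ 2 + ‖D (x - Complex.I • y)‖ ^ 2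
      = 2 * (‖D x‖ ^ 2 + ‖D y‖ ^ 2) := fun D => by rw [aux_par D x (Complex.I • y), hI]
  have hn : ‖@inner ℂ _ _ (cmt (adjoint A) B y) x‖ ≤
      (‖@inner ℂ _ _ (cmt (adjoint A) B (x + y)) (x + y)‖
      + ‖@inner ℂ _ _ (cmt (adjoint A) B (x - y)) (x - y)‖
      + ‖@inner ℂ _ _ (cmt (adjoint A) B (x + Complex.I • y)) (x + Complex.I • y)‖
      + ‖@inner ℂ _ _ (cmt (adjoint A) B (x - Complex.I • y)) (x - Complex.I • y)‖) / 4 := by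
    rw [hp, norm_div]
    simp only [RCLike.norm_ofNat]
    gcongr
    refine (norm_sub_le _ _).trans ?_
    rw [norm_mul, Complex.norm_I, one_mul]
    gcongr
    refine (norm_add_le _ _).trans ?_
    rw [norm_mul, Complex.norm_I, one_mul]
    gcongr
    exact norm_sub_le _ _
  have a1 := p1 A
  have a2 := p1 (adjoint A)
  have a3 := p1 B
  have a4 := p1 (adjoint B)
  have b1 := p2 A
  have b2 := p2 (adjoint A)
  have b3 := p2 B
  have b4 := p2 (adjoint B)
  linarith

lemma aux_le_traceNorm (A : H →L[ℂ] H) {n : ℕ} (f : Fin n → H) (hf : Orthonormal ℂ f) :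
    ENNReal.ofReal (∑ i, (‖A (f i)‖ ^ 2 - ‖adjoint A (f i)‖ ^ 2)) ≤
      traceNorm (cmt (adjoint A) A) := by
  have h1 : ENNReal.ofReal (∑ i, (‖A (f i)‖ ^ 2 - ‖adjoint A (f i)‖ ^ 2)) ≤
      ∑ i, (‖@inner ℂ _ _ (cmt (adjoint A) A (f i)) (f i)‖₊ : ℝ≥0∞) := by
    have : ∑ i, (‖@inner ℂ _ _ (cmt (adjoint A) A (f i)) (f i)‖₊ : ℝ≥0∞) =
        ENNReal.ofReal (∑ i, ‖@inner ℂ _ _ (cmt (adjoint A) A (f i)) (f i)‖) := by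
      rw [ENNReal.ofReal_sum_of_nonneg (fun i _ => norm_nonneg _)]
      exact Finset.sum_congr rfl fun i _ => (ofReal_norm_eq_enorm _).symm
    rw [this]
    apply ENNReal.ofReal_le_ofReal
    apply Finset.sum_le_sum
    intro i _
    rw [← aux_q]
    exact RCLike.re_le_norm _
  refine h1.trans ?_
  unfold traceNorm
  exact le_iSup_of_le n (le_iSup_of_le f (le_iSup_of_le f (le_iSup_of_le hf
    (le_iSup_of_le hf le_rfl))))

lemma aux_main_s4 (A B : H →L[ℂ] H) (h : ∀ b : ℂ, Hyponormal (A + b • B))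
    (hA : IsTraceClass (cmt (adjoint A) A)) (hB : IsTraceClass (cmt (adjoint B) B)) :
    traceNorm (cmt (adjoint A) B) ≤
      traceNorm (cmt (adjoint B) B) + traceNorm (cmt (adjoint A) A) := by
  conv_lhs => unfold traceNorm
  refine iSup_le fun n => iSup_le fun f => iSup_le fun g => iSup_le fun hf => iSup_le fun hg => ?_
  have key : ∀ (A : H →L[ℂ] H), IsTraceClass (cmt (adjoint A) A) → ∀ f : Fin n → H,
      Orthonormal ℂ f → ∑ i, (‖A (f i)‖ ^ 2 - ‖adjoint A (f i)‖ ^ 2) ≤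
      (traceNorm (cmt (adjoint A) A)).toReal := fun A hA f hf =>
    (ENNReal.ofReal_le_iff_le_toReal hA).1 (aux_le_traceNorm A f hf)
  have e : ∑ i, (‖@inner ℂ _ _ (cmt (adjoint A) B (f i)) (g i)‖₊ : ℝ≥0∞) =
      ENNReal.ofReal (∑ i, ‖@inner ℂ _ _ (cmt (adjoint A) B (f i)) (g i)‖) := by
    rw [ENNReal.ofReal_sum_of_nonneg (fun i _ => norm_nonneg _)]
    exact Finset.sum_congr rfl fun i _ => (ofReal_norm_eq_enorm _).symm
  rw [e, ENNReal.ofReal_le_iff_le_toReal (ENNReal.add_ne_top.2 ⟨hB, hA⟩),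
    ENNReal.toReal_add hB hA]
  have hs := Finset.sum_le_sum fun i (_ : i ∈ Finset.univ) => aux_off A B h (f i) (g i)
  rw [← Finset.mul_sum, Finset.sum_add_distrib, Finset.sum_add_distrib,
    Finset.sum_add_distrib] at hs
  have k1 := key A hA f hf
  have k2 := key A hA g hg
  have k3 := key B hB f hf
  have k4 := key B hB g hg
  linarith

/-- for a commuting projectively hyponormal tuple with trace class
self-commutators, all mixed commutators are trace class with
`‖[T j*, T k]‖₁ ≤ ‖[T k*, T k]‖₁ + ‖[T j*, T j]‖₁`. -/
theorem statement_4 {d : ℕ} [TopologicalSpace.SeparableSpace H]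
    (T : Fin d → H →L[ℂ] H) (hcomm : ∀ i j, Commute (T i) (T j))
    (hph : ProjHyponormal T)
    (htc : ∀ k, IsTraceClass (cmt (adjoint (T k)) (T k))) :
    ∀ j k, IsTraceClass (cmt (adjoint (T j)) (T k)) ∧
      traceNorm (cmt (adjoint (T j)) (T k)) ≤
        traceNorm (cmt (adjoint (T k)) (T k)) + traceNorm (cmt (adjoint (T j)) (T j)) := by
  intro j k
  have h : ∀ b : ℂ, Hyponormal (T j + b • T k) := by
    intro b
    have h1 := hph (Pi.single j 1 + Pi.single k b)
    have e : ∑ i, (Pi.single j (1 : ℂ) + Pi.single k b : Fin d → ℂ) i • T i = T j + b • T k := by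
      simp [Pi.single_apply, add_smul, Finset.sum_add_distrib, ite_smul]
    rwa [e] at h1
  have hm := aux_main_s4 (T j) (T k) h (htc j) (htc k)
  exact ⟨ne_top_of_le_ne_top (ENNReal.add_ne_top.2 ⟨htc k, htc j⟩) hm, hm⟩
end
end
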